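/- arXiv:math/0304205 — 2 statements merged into one kernel-verified Lean document; each statement's English description precedes it below -/
import Mathlib

section
/- Let H be a subgroup of the symmetric group Sym(ℕ) of all permutations of ℕ. If the index of H in Sym(ℕ) is strictly less than 2^ℵ₀, then there exists a finite set A ⊆ ℕ such that the pointwise stabilizer of A is contained in H. -/
namespace SIP

open Equiv

lemma perm_inv_self {α : Type*} (f : Perm α) (x : α) : f⁻¹ (f x) = x := f.symm_apply_apply x

lemma perm_self_inv {α : Type*} (f : Perm α) (x : α) : f (f⁻¹ x) = x := f.apply_symm_apply x

/-- Two distinct indices give the same left coset. -/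
lemma pigeon (H : Subgroup (Perm ℕ))
    (hindex : Cardinal.mk (Perm ℕ ⧸ H) < 2 ^ Cardinal.aleph0)
    (f : (ℕ → Bool) → Perm ℕ) : ∃ a b, a ≠ b ∧ (f a)⁻¹ * f b ∈ H := by
  by_contra hcon
  push Not at hcon
  have hinj : Function.Injective (fun a => (QuotientGroup.mk (f a) : Perm ℕ ⧸ H)) := by
    intro a b hab
    by_contra hne
    exact hcon a b hne (QuotientGroup.eq.1 hab)
  have h1 := Cardinal.mk_le_of_injective hinj
  have h2 : Cardinal.mk (ℕ → Bool) = 2 ^ Cardinal.aleph0 := by simp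
  rw [h2] at h1
  exact absurd hindex (not_lt.2 h1)

/-- An almost disjoint family of size continuum. -/
lemma almostDisjoint : ∃ A : (ℕ → Bool) → Set ℕ, (∀ a, (A a).Infinite) ∧
    ∀ a b, a ≠ b → (A a ∩ A b).Finite := by
  refine ⟨fun a => Set.range (fun n => Encodable.encode ((List.range n).map a)), ?_, ?_⟩
  · intro a
    apply Set.infinite_range_of_injective
    intro n m h
    have := congrArg List.length (Encodable.encode_injective h)
    simpa using this
  · intro a b hab
    obtain ⟨k, hk⟩ := Function.ne_iff.1 hab
    apply ((Set.finite_Iic k).image (fun n => Encodable.encode ((List.range n).map a))).subset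
    rintro _ ⟨⟨n, rfl⟩, ⟨m, hm⟩⟩
    refine ⟨n, ?_, rfl⟩
    have h := Encodable.encode_injective hm
    have hl : m = n := by simpa using congrArg List.length h
    subst hl
    by_contra hlt
    simp only [Set.mem_Iic, not_le] at hlt
    have := List.map_inj_left.1 h k (List.mem_range.2 hlt)
    exact hk this.symm

/-- Extension of partial injections. -/
lemma extend (S X : Set ℕ) (f : ℕ → ℕ) (hX : X ⊆ S) (hf : Set.InjOn f X)
    (hm : Set.MapsTo f X S) (h1 : (S \ X).Infinite) (h2 : (S \ f '' X).Infinite) :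
    ∃ p : Perm ℕ, (∀ x, x ∉ S → p x = x) ∧ ∀ x ∈ X, p x = f x := by
  classical
  have := h1.to_subtype
  have := h2.to_subtype
  obtain ⟨e⟩ : Nonempty (↥(S \ X) ≃ ↥(S \ f '' X)) := nonempty_equiv_of_countable
  let F : ℕ → ℕ := fun n => if n ∈ X then f n else
    if h : n ∈ S \ X then (e ⟨n, h⟩ : ℕ) else n
  have F1 : ∀ n ∈ X, F n = f n := fun n hn => by simp only [F, if_pos hn]
  have F2 : ∀ n (h : n ∈ S \ X), F n = e ⟨n, h⟩ := fun n h => by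
    simp only [F, if_neg h.2, dif_pos h]
  have F3 : ∀ n, n ∉ S → F n = n := fun n h => by
    have ha : n ∉ X := fun hx => h (hX hx)
    have hb : n ∉ S \ X := fun hx => h hx.1
    simp only [F, if_neg ha, dif_neg hb]
  have B1 : Set.BijOn F X (f '' X) := by
    refine (hf.bijOn_image).congr ?_
    intro n hn; exact (F1 n hn).symm
  have B2 : Set.BijOn F (S \ X) (S \ f '' X) := by
    refine ⟨?_, ?_, ?_⟩
    · intro n hn; rw [F2 n hn]; exact (e ⟨n, hn⟩).2
    · intro n hn m hm' h
      rw [F2 n hn, F2 m hm'] at h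
      have := e.injective (Subtype.ext h)
      exact congrArg Subtype.val this
    · intro m hm'
      refine ⟨e.symm ⟨m, hm'⟩, (e.symm ⟨m, hm'⟩).2, ?_⟩
      rw [F2 _ (e.symm ⟨m, hm'⟩).2]; simp
  have hbij : Function.Bijective F := by
    constructor
    · intro n m h
      have c1 := @F1; have c2 := @F2; have c3 := @F3
      by_cases hnS : n ∈ S
      · by_cases hnX : n ∈ X
        · have hn' := B1.mapsTo hnX
          by_cases hmX : m ∈ X
          · exact B1.injOn hnX hmX h
          · by_cases hmS : m ∈ S
            · have := B2.mapsTo (show m ∈ S \ X from ⟨hmS, hmX⟩)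
              rw [← h] at this; exact absurd hn' this.2
            · rw [F3 m hmS, F1 n hnX] at h
              exact absurd (h ▸ hm hnX) hmS
        · have hn' := B2.mapsTo (show n ∈ S \ X from ⟨hnS, hnX⟩)
          by_cases hmX : m ∈ X
          · have := B1.mapsTo hmX
            rw [← h] at this; exact absurd this hn'.2
          · by_cases hmS : m ∈ S
            · exact B2.injOn ⟨hnS, hnX⟩ ⟨hmS, hmX⟩ h
            · rw [h, F3 m hmS] at hn'
              exact absurd hn'.1 hmS
      · rw [F3 n hnS] at h
        by_cases hmX : m ∈ X
        · rw [F1 m hmX] at h; exact absurd (h ▸ hm hmX) hnS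
        · by_cases hmS : m ∈ S
          · have := B2.mapsTo (show m ∈ S \ X from ⟨hmS, hmX⟩)
            rw [← h] at this; exact absurd this.1 hnS
          · rw [F3 m hmS] at h; exact h
    · intro y
      by_cases hyS : y ∈ S
      · by_cases hy : y ∈ f '' X
        · obtain ⟨x, _, hx⟩ := B1.surjOn hy; exact ⟨x, hx⟩
        · obtain ⟨x, _, hx⟩ := B2.surjOn (show y ∈ S \ f '' X from ⟨hyS, hy⟩); exact ⟨x, hx⟩
      · exact ⟨y, F3 y hyS⟩
  exact ⟨Equiv.ofBijective F hbij, fun x hx => F3 x hx, fun x hx => F1 x hx⟩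

/-- `SymIn K S`: every permutation supported in `S` lies in `K`. -/
def SymIn (K : Subgroup (Perm ℕ)) (S : Set ℕ) : Prop :=
  ∀ g : Perm ℕ, (∀ x, x ∉ S → g x = x) → g ∈ K

lemma gen_good (K : Subgroup (Perm ℕ)) (S T : Set ℕ) (hS : SymIn K S) (hT : SymIn K T)
    (hI : (S ∩ T).Infinite) (g : Perm ℕ) (hg : ∀ x, x ∉ S ∪ T → g x = x)
    (hgood : (S ∩ g '' S).Infinite) : g ∈ K := by
  let j := hI.natEmbedding
  have hj : ∀ n, (j n : ℕ) ∈ S ∩ T := fun n => (j n).2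
  have jinj : ∀ m n, (j m : ℕ) = j n → m = n := fun m n h => j.injective (Subtype.ext h)
  have hodd : (Set.range (fun k => (j (2 * k + 1) : ℕ))).Infinite := by
    apply Set.infinite_range_of_injective
    intro a b h
    have := jinj _ _ h
    omega
  have gU : ∀ x ∈ S ∪ T, g x ∈ S ∪ T := by
    intro x hx
    by_contra h
    exact h (by rwa [g.injective (hg _ h)])
  let D := T \ S
  obtain ⟨a, ha1, ha2⟩ := extend S (S ∩ g '' D) (fun y => (j (2 * y) : ℕ))
    Set.inter_subset_left
    (by intro x _ y _ h; have := jinj _ _ h; omega)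
    (fun x _ => (hj _).1)
    (by
      refine hgood.mono ?_
      rintro _ ⟨h1, ⟨x, hx, rfl⟩⟩
      refine ⟨h1, ?_⟩
      rintro ⟨_, ⟨y, hy, hyx⟩⟩
      rw [g.injective hyx] at hy
      exact hy.2 hx)
    (by
      refine hodd.mono ?_
      rintro _ ⟨k, rfl⟩
      refine ⟨(hj _).1, ?_⟩
      rintro ⟨y, _, hy⟩
      have := jinj _ _ hy
      omega)
  have hD : ∀ d ∈ D, (g d ∈ S ∧ a (g d) = j (2 * g d)) ∨ (g d ∈ T ∧ g d ∉ S ∧ a (g d) = g d) := by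
    intro d hd
    by_cases h : g d ∈ S
    · exact Or.inl ⟨h, ha2 _ ⟨h, d, hd, rfl⟩⟩
    · exact Or.inr ⟨(gU d (Or.inr hd.1)).resolve_left h, h, ha1 _ h⟩
  obtain ⟨b, hb1, hb2⟩ := extend T ((a * g) '' D) ((a * g)⁻¹ : Perm ℕ)
    (by
      rintro _ ⟨d, hd, rfl⟩
      rcases hD d hd with ⟨_, h2⟩ | ⟨h1, _, h2⟩
      · rw [Perm.mul_apply, h2]; exact (hj _).2
      · rw [Perm.mul_apply, h2]; exact h1)
    (Equiv.injective _).injOn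
    (by
      rintro _ ⟨d, hd, rfl⟩
      rw [perm_inv_self]; exact hd.1)
    (by
      refine hodd.mono ?_
      rintro _ ⟨k, rfl⟩
      refine ⟨(hj _).2, ?_⟩
      rintro ⟨d, hd, h⟩
      rw [Perm.mul_apply] at h
      rcases hD d hd with ⟨_, h2⟩ | ⟨_, h1, h2⟩
      · rw [h2] at h
        have := jinj _ _ h
        omega
      · rw [h2] at h
        exact h1 (h ▸ (hj _).1))
    (by
      refine hI.mono ?_
      rintro x ⟨hx1, hx2⟩
      refine ⟨hx2, ?_⟩
      rintro ⟨_, ⟨d, hd, rfl⟩, h⟩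
      rw [perm_inv_self] at h
      exact hd.2 (h ▸ hx1))
  have haK : a ∈ K := hS a ha1
  have hbK : b ∈ K := hT b hb1
  have hc : b * (a * g) ∈ K := by
    apply hS
    intro x hx
    rw [Perm.mul_apply]
    by_cases hxT : x ∈ T
    · rw [hb2 _ ⟨x, ⟨hxT, hx⟩, rfl⟩, perm_inv_self]
    · rw [Perm.mul_apply, hg x (by rintro (h | h); exacts [hx h, hxT h]), ha1 x hx, hb1 x hxT]
  exact (K.mul_mem_cancel_left haK).1 ((K.mul_mem_cancel_left hbK).1 hc)

lemma gen (K : Subgroup (Perm ℕ)) (S T : Set ℕ) (hS : SymIn K S) (hT : SymIn K T)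
    (hI : (S ∩ T).Infinite) : SymIn K (S ∪ T) := by
  intro g hg
  by_cases h1 : (S ∩ g '' S).Infinite
  · exact gen_good K S T hS hT hI g hg h1
  by_cases h2 : (T ∩ g '' T).Infinite
  · exact gen_good K T S hT hS (by rwa [Set.inter_comm]) g (by rwa [Set.union_comm]) h2
  exfalso
  rw [Set.not_infinite] at h1 h2
  apply hI.image g.injective.injOn
  refine (h1.union h2).subset ?_
  rintro _ ⟨x, hx, rfl⟩
  have gU : g x ∈ S ∪ T := by
    by_contra h
    exact h (by rw [g.injective (hg _ h)]; exact Or.inl hx.1)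
  rcases gU with h | h
  · exact Or.inl ⟨h, x, hx.1, rfl⟩
  · exact Or.inr ⟨h, x, hx.2, rfl⟩

/-- Gluing of permutations along the classes of a map `c`. -/
def glue (c : ℕ → ℕ) (x : ℕ → Perm ℕ) (hx : ∀ n, c (x (c n) n) = c n)
    (hx' : ∀ n, c ((x (c n))⁻¹ n) = c n) : Perm ℕ where
  toFun n := x (c n) n
  invFun n := (x (c n))⁻¹ n
  left_inv n := by simp only [hx, perm_inv_self]
  right_inv n := by simp only [hx', perm_self_inv]

lemma full (H : Subgroup (Perm ℕ))
    (hindex : Cardinal.mk (Perm ℕ ⧸ H) < 2 ^ Cardinal.aleph0) (c : ℕ → ℕ) :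
    ∃ i, ∀ g : Perm ℕ, (∀ n, c n ≠ i → g n = n) → ∃ h ∈ H, ∀ n, c n = i → h n = g n := by
  by_contra hcon
  push Not at hcon
  choose x hx1 hx2 using hcon
  have pres : ∀ (y : Perm ℕ) (i : ℕ), (∀ n, c n ≠ i → y n = n) → ∀ n, c n = i → c (y n) = i := by
    intro y i hy n hn
    by_contra h
    have := y.injective (hy _ h)
    rw [this] at h
    exact h hn
  have hinv : ∀ i n, c n ≠ i → (x i)⁻¹ n = n := by
    intro i n hn
    rw [Perm.inv_eq_iff_eq, hx1 i n hn]
  let z : (ℕ → Bool) → ℕ → Perm ℕ := fun a i => if a i then x i else 1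
  have hz1 : ∀ a i n, c n ≠ i → z a i n = n := by
    intro a i n hn
    simp only [z]; split_ifs
    · exact hx1 i n hn
    · rfl
  have hz2 : ∀ a i n, c n ≠ i → (z a i)⁻¹ n = n := by
    intro a i n hn
    rw [Perm.inv_eq_iff_eq, hz1 a i n hn]
  let f : (ℕ → Bool) → Perm ℕ := fun a => glue c (z a)
    (fun n => pres _ _ (hz1 a (c n)) n rfl) (fun n => pres _ _ (hz2 a (c n)) n rfl)
  have key : ∀ a b k, a k = false → b k = true → (f a)⁻¹ * f b ∈ H → False := by
    intro a b k hak hbk hH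
    obtain ⟨n, hn, hne⟩ := hx2 k _ hH
    apply hne
    have e1 : f b n = x k n := by
      change z b (c n) n = _
      simp only [z, hn, hbk, if_true]
    have e2 : f a (x k n) = x k n := by
      change z a (c (x k n)) _ = _
      rw [pres _ k (hx1 k) n hn]
      simp [z, hak]
    rw [Perm.mul_apply, e1, Perm.inv_eq_iff_eq, e2]
  obtain ⟨a, b, hab, hH⟩ := pigeon H hindex f
  obtain ⟨k, hk⟩ := Function.ne_iff.1 hab
  cases ha : a k <;> cases hb : b k
  · simp [ha, hb] at hk
  · exact key a b k ha hb hH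
  · refine key b a k hb ha ?_
    have := H.inv_mem hH
    simpa using this
  · simp [ha, hb] at hk

/-- The involution of `ℕ × Bool` flipping the fibres above `A`. -/
noncomputable def flip (A : Set ℕ) : Perm (ℕ × Bool) :=
  open Classical in
  Function.Involutive.toPerm (fun p => (p.1, xor p.2 (decide (p.1 ∈ A))))
    (by rintro ⟨n, b⟩; simp)

lemma flip_mem {A : Set ℕ} {n : ℕ} (h : n ∈ A) (b : Bool) : flip A (n, b) = (n, !b) := by
  change (n, xor b _) = _
  simp [h]

lemma flip_notMem {A : Set ℕ} {n : ℕ} (h : n ∉ A) (b : Bool) : flip A (n, b) = (n, b) := by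
  change (n, xor b _) = _
  simp [h]

/-- Commutators of permutations supported on some infinite set lie in `H`. -/
lemma commutators (H : Subgroup (Perm ℕ))
    (hindex : Cardinal.mk (Perm ℕ ⧸ H) < 2 ^ Cardinal.aleph0) :
    ∃ B : Set ℕ, B.Infinite ∧ ∀ g h : Perm ℕ, (∀ n, n ∉ B → g n = n) →
      (∀ n, n ∉ B → h n = n) → g * h * g⁻¹ * h⁻¹ ∈ H := by
  obtain ⟨i, hi⟩ := full H hindex (fun n => n.unpair.1)
  obtain ⟨A, hA1, hA2⟩ := almostDisjoint
  let ι : ℕ × Bool ↪ ℕ := ⟨fun p => Nat.pair i (2 * p.1 + p.2.toNat), by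
    rintro ⟨n, b⟩ ⟨m, d⟩ h
    have := (Nat.pair_eq_pair.1 h).2
    cases b <;> cases d <;> simp at this ⊢ <;> omega⟩
  have hι : ∀ p, (ι p).unpair.1 = i := by 
    intro p
    change (Nat.unpair (Nat.pair i _)).1 = i
    simp
  obtain ⟨a, b, hab, hs⟩ := pigeon H hindex (fun a => (flip (A a)).viaEmbedding ι)
  set s : Perm ℕ := ((flip (A a)).viaEmbedding ι)⁻¹ * (flip (A b)).viaEmbedding ι with hs_def
  have hoff : ∀ n, n.unpair.1 ≠ i → s n = n := by
    intro n hn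
    have : n ∉ Set.range ι := by rintro ⟨p, rfl⟩; exact hn (hι p)
    rw [hs_def, Perm.mul_apply, Perm.viaEmbedding_apply_of_notMem _ _ _ this,
      Perm.inv_eq_iff_eq, Perm.viaEmbedding_apply_of_notMem _ _ _ this]
  let B : Set ℕ := (fun n => ι (n, false)) '' (A a \ A b)
  have hBi : ∀ n ∈ B, n.unpair.1 = i := by rintro _ ⟨n, _, rfl⟩; exact hι _
  have hsB : ∀ n ∈ B, s n ∉ B := by
    rintro _ ⟨n, hn, rfl⟩
    have : s (ι (n, false)) = ι (n, true) := by
      rw [hs_def, Perm.mul_apply, Perm.viaEmbedding_apply, flip_notMem hn.2,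
        Perm.inv_eq_iff_eq, Perm.viaEmbedding_apply, flip_mem hn.1]
      rfl
    simp only [this]
    rintro ⟨m, _, hm⟩
    have := ι.injective hm
    simp at this
  refine ⟨B, ?_, ?_⟩
  · apply Set.Infinite.image
    · intro n _ m _ h
      have := ι.injective h
      simpa using this
    · intro hfin
      refine hA1 a ((hfin.union (hA2 a b hab)).subset ?_)
      intro n hn
      by_cases h : n ∈ A b
      · exact Or.inr ⟨hn, h⟩
      · exact Or.inl ⟨hn, h⟩
  · intro g h hg hh
    have stab : ∀ (y : Perm ℕ) (P : ℕ → Prop), (∀ n, ¬ P n → y n = n) → ∀ n, P n → P (y n) := by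
      intro y P hy n hn
      by_contra hc
      rw [y.injective (hy _ hc)] at hc
      exact hc hn
    -- a permutation supported in the class may be conjugated as if `g ∈ H`
    have conjH : ∀ y ∈ H, (∀ n, n.unpair.1 ≠ i → y n = n) → ∀ k : Perm ℕ,
        (∀ n, n ∉ B → k n = n) → k * y * k⁻¹ ∈ H := by
      intro y hyH hy k hk
      have hk0 : ∀ n, n.unpair.1 ≠ i → k n = n := fun n hn => hk n (fun hb => hn (hBi n hb))
      obtain ⟨k', hk'H, hk'⟩ := hi k hk0
      have : k * y * k⁻¹ = k' * y * k'⁻¹ := by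
        rw [mul_inv_eq_iff_eq_mul]
        ext n
        simp only [Perm.mul_apply]
        by_cases hn : n.unpair.1 = i
        · have e : k'⁻¹ (k n) = n := by rw [Perm.inv_eq_iff_eq, hk' n hn]
          rw [e, hk' _ (stab y (fun n => n.unpair.1 = i) hy n hn)]
        · have e : (k'⁻¹ n).unpair.1 ≠ i := by
            intro hc
            have h1 := hk' _ hc
            rw [perm_self_inv] at h1
            have h2 := stab k (fun n => n.unpair.1 = i) hk0 _ hc
            simp only [← h1] at h2
            exact hn h2
          rw [hy n hn, hk0 n hn, hy _ e, perm_self_inv]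
      rw [this]
      exact H.mul_mem (H.mul_mem hk'H hyH) (H.inv_mem hk'H)
    let u := g * s * g⁻¹ * s⁻¹
    have hginv : ∀ n, n ∉ B → g⁻¹ n = n := fun n hn => by rw [Perm.inv_eq_iff_eq, hg n hn]
    have hhinv : ∀ n, n ∉ B → h⁻¹ n = n := fun n hn => by rw [Perm.inv_eq_iff_eq, hh n hn]
    have hsinv : ∀ n, n.unpair.1 ≠ i → s⁻¹ n = n := fun n hn => by
      rw [Perm.inv_eq_iff_eq, hoff n hn]
    have huH : u ∈ H := H.mul_mem (conjH s hs hoff g hg) (H.inv_mem hs)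
    have hu0 : ∀ n, n.unpair.1 ≠ i → u n = n := by
      intro n hn
      have hnB : n ∉ B := fun hb => hn (hBi n hb)
      simp only [u, Perm.mul_apply]
      rw [hsinv n hn, hginv n hnB, hoff n hn, hg n hnB]
    -- `u = g * v` with `v` commuting with `h`
    have huinv : ∀ n, n.unpair.1 ≠ i → u⁻¹ n = n := fun n hn => by
      rw [Perm.inv_eq_iff_eq, hu0 n hn]
    have h2 : h * u⁻¹ * h⁻¹ ∈ H := conjH _ (H.inv_mem huH) huinv h hh
    have hfin : u * (h * u⁻¹ * h⁻¹) ∈ H := H.mul_mem huH h2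
    let v := s * g⁻¹ * s⁻¹
    have hvB : ∀ n ∈ B, v n = n := by
      intro n hn
      simp only [v, Perm.mul_apply]
      have : s⁻¹ n ∉ B := by
        intro hc
        have := hsB _ hc
        rw [perm_self_inv] at this
        exact this hn
      rw [hginv _ this, perm_self_inv]
    have hcomm : v * h = h * v := by
      apply Equiv.ext
      intro n
      simp only [Perm.mul_apply]
      by_cases hn : n ∈ B
      · rw [hvB n hn, hvB _ (stab h (· ∈ B) hh n hn)]
      · rw [hh n hn, hh]
        intro hc
        have := v.injective (hvB _ hc)
        rw [this] at hc
        exact hn hc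
    have huv : u = g * v := by simp only [u, v, mul_assoc]
    have : g * h * g⁻¹ * h⁻¹ = u * (h * u⁻¹ * h⁻¹) := by
      rw [huv, mul_inv_rev]
      calc g * h * g⁻¹ * h⁻¹ = g * (h * v) * v⁻¹ * g⁻¹ * h⁻¹ := by group
        _ = g * (v * h) * v⁻¹ * g⁻¹ * h⁻¹ := by rw [hcomm]
        _ = _ := by group
    rw [this]
    exact hfin

/-- The permutation acting as `p` on the levels in `L`. -/
noncomputable def level (p : Perm ℕ) (L : Set ℤ) : Perm (ℤ × ℕ) :=
  open Classical in
  { toFun := fun q => (q.1, if q.1 ∈ L then p q.2 else q.2)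
    invFun := fun q => (q.1, if q.1 ∈ L then p⁻¹ q.2 else q.2)
    left_inv := by rintro ⟨n, m⟩; by_cases h : n ∈ L <;> simp [h]
    right_inv := by rintro ⟨n, m⟩; by_cases h : n ∈ L <;> simp [h] }

lemma level_comm (p : Perm ℕ) (t : Perm (ℤ × ℕ)) (ht : ∀ n m, t (n, m) = (n + 1, m)) :
    level p {0} = level p (Set.Ici 0) * t * (level p (Set.Ici 0))⁻¹ * t⁻¹ := by
  rw [eq_mul_inv_iff_mul_eq, eq_mul_inv_iff_mul_eq]
  apply Equiv.ext
  rintro ⟨n, m⟩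
  simp only [Perm.mul_apply, ht]
  simp only [level, Equiv.coe_fn_mk, ht, Set.mem_Ici, Set.mem_singleton_iff]
  by_cases h : 0 ≤ n
  · have h1 : n + 1 ≠ 0 := by omega
    have h2 : 0 ≤ n + 1 := by omega
    simp [h, h1, h2]
  · by_cases h1 : n + 1 = 0
    · simp [h, h1]
    · have h2 : ¬ 0 ≤ n + 1 := by omega
      simp [h, h1, h2]

lemma moiety (H : Subgroup (Perm ℕ))
    (hindex : Cardinal.mk (Perm ℕ ⧸ H) < 2 ^ Cardinal.aleph0) :
    ∃ C : Set ℕ, C.Infinite ∧ Cᶜ.Infinite ∧ SymIn H C := by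
  classical
  obtain ⟨B, hB, hcom⟩ := commutators H hindex
  have := hB.to_subtype
  obtain ⟨e⟩ : Nonempty (ℤ × ℕ ≃ B) := nonempty_equiv_of_countable
  let ι : ℤ × ℕ ↪ ℕ := e.toEmbedding.trans (Function.Embedding.subtype _)
  have hιB : ∀ n, n ∉ B → n ∉ Set.range ι := by
    rintro n hn ⟨q, rfl⟩
    exact hn (e q).2
  let C : Set ℕ := Set.range (fun m : ℕ => ι (0, m))
  refine ⟨C, ?_, ?_, ?_⟩
  · apply Set.infinite_range_of_injective
    intro a b h
    simpa using ι.injective h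
  · have : (Set.range (fun m : ℕ => ι (1, m))).Infinite := by
      apply Set.infinite_range_of_injective
      intro a b h
      simpa using ι.injective h
    refine this.mono ?_
    rintro _ ⟨m, rfl⟩ ⟨k, hk⟩
    have := ι.injective hk
    simp at this
  · intro g hg
    let t : Perm (ℤ × ℕ) :=
      { toFun := fun q => (q.1 + 1, q.2)
        invFun := fun q => (q.1 - 1, q.2)
        left_inv := by rintro ⟨n, m⟩; simp
        right_inv := by rintro ⟨n, m⟩; simp }
    have gC : ∀ n, g n ∈ C ↔ n ∈ C := by
      intro n
      constructor
      · intro h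
        by_contra hn
        rw [hg n hn] at h
        exact hn h
      · intro hn
        by_contra hc
        rw [g.injective (hg _ hc)] at hc
        exact hc hn
    let d : ℕ ≃ C := Equiv.ofInjective (fun m : ℕ => ι (0, m)) (by
      intro a b h
      simpa using ι.injective h)
    let p : Perm ℕ := (d.trans (g.subtypePerm gC)).trans d.symm
    have hd : ∀ m, (d m : ℕ) = ι (0, m) := fun m => rfl
    have hp : ∀ m, ι (0, p m) = g (ι (0, m)) := by
      intro m
      rw [← hd, ← hd]
      simp [p]
    have hgl : g = (level p {0}).viaEmbedding ι := by
      apply Equiv.ext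
      intro n
      by_cases hn : n ∈ Set.range ι
      · obtain ⟨⟨k, m⟩, rfl⟩ := hn
        rw [Perm.viaEmbedding_apply]
        by_cases hk : k = 0
        · subst hk
          rw [← hp]; simp [level]
        · rw [hg]
          · simp [level, hk]
          · rintro ⟨m', hm'⟩
            have := ι.injective hm'
            simp at this
            exact hk this.1.symm
      · rw [Perm.viaEmbedding_apply_of_notMem _ _ _ hn, hg]
        rintro ⟨m, rfl⟩
        exact hn ⟨_, rfl⟩
    have := hcom ((level p (Set.Ici 0)).viaEmbedding ι) (t.viaEmbedding ι)
      (fun n hn => Perm.viaEmbedding_apply_of_notMem _ _ _ (hιB n hn))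
      (fun n hn => Perm.viaEmbedding_apply_of_notMem _ _ _ (hιB n hn))
    rw [hgl, level_comm p t (fun _ _ => rfl)]
    simp only [← Perm.viaEmbeddingHom_apply] at this ⊢
    simpa only [map_mul, map_inv] using this

end SIP

/-- Small index property for the countable infinite set (Semmes; Dixon–Neumann–Thomas):
any subgroup of `Sym(ℕ)` of index `< 2^ℵ₀` contains the pointwise stabilizer of a
finite set. -/
theorem smallIndexProperty_symNat (H : Subgroup (Equiv.Perm ℕ))
    (hindex : Cardinal.mk (Equiv.Perm ℕ ⧸ H) < 2 ^ Cardinal.aleph0) :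
    ∃ A : Set ℕ, A.Finite ∧ ∀ g : Equiv.Perm ℕ, (∀ a ∈ A, g a = a) → g ∈ H := by
  obtain ⟨C, hC1, hC2, hC⟩ := SIP.moiety H hindex
  obtain ⟨A, hA1, hA2⟩ := SIP.almostDisjoint
  -- permutations carrying the complement of `C` onto the doubled set `2 * A a`
  have hx : ∀ a, ∃ p : Equiv.Perm ℕ, ∀ n, (p n ∈ (fun k => 2 * k) '' A a ↔ n ∉ C) := by
    intro a
    have hinf : ((fun k => 2 * k) '' A a).Infinite :=
      (hA1 a).image (fun x _ y _ h => by simpa using h)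
    have := hinf.to_subtype
    have := hC2.to_subtype
    obtain ⟨e⟩ : Nonempty (↥(Cᶜ) ≃ ↥((fun k => 2 * k) '' A a)) := nonempty_equiv_of_countable
    classical
    let f : ℕ → ℕ := fun n => if h : n ∈ Cᶜ then (e ⟨n, h⟩ : ℕ) else n
    have hf : ∀ n (h : n ∈ Cᶜ), f n = e ⟨n, h⟩ := fun n h => dif_pos h
    have him : f '' Cᶜ = (fun k => 2 * k) '' A a := by
      ext y
      constructor
      · rintro ⟨n, hn, rfl⟩
        rw [hf n hn]; exact (e ⟨n, hn⟩).2
      · intro hy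
        refine ⟨e.symm ⟨y, hy⟩, (e.symm ⟨y, hy⟩).2, ?_⟩
        rw [hf _ (e.symm ⟨y, hy⟩).2]; simp
    obtain ⟨p, _, hp⟩ := SIP.extend Set.univ Cᶜ f (Set.subset_univ _)
      (by
        intro n hn m hm h
        rw [hf n hn, hf m hm] at h
        exact congrArg Subtype.val (e.injective (Subtype.ext h)))
      (fun _ _ => trivial)
      (by rw [← Set.compl_eq_univ_sdiff, compl_compl]; exact hC1)
      (by
        rw [him]
        have : (Set.range (fun k : ℕ => 2 * k + 1)).Infinite :=
          Set.infinite_range_of_injective (fun x y h => by simpa using h)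
        refine this.mono ?_
        rintro _ ⟨k, rfl⟩
        refine ⟨trivial, ?_⟩
        rintro ⟨l, _, hl⟩
        simp only at hl
        omega)
    refine ⟨p, fun n => ⟨?_, ?_⟩⟩
    · intro h
      rw [← him] at h
      obtain ⟨m, hm, hmn⟩ := h
      rw [← hp m hm] at hmn
      rw [← p.injective hmn]
      exact hm
    · intro h
      rw [hp n h, ← him]
      exact ⟨n, h, rfl⟩
  choose x hx using hx
  obtain ⟨a, b, hab, hy⟩ := SIP.pigeon H hindex x
  set y := (x a)⁻¹ * x b with hy_def
  -- the translate of `C` by `y`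
  let T : Set ℕ := {n | y⁻¹ n ∈ C}
  have hT : SIP.SymIn H T := by
    intro g hg
    have : y⁻¹ * g * y ∈ H := by
      apply hC
      intro n hn
      simp only [Equiv.Perm.mul_apply]
      rw [hg (y n) (by simpa [T] using hn), SIP.perm_inv_self]
    have h2 := H.mul_mem (H.mul_mem hy this) (H.inv_mem hy)
    have e : y * (y⁻¹ * g * y) * y⁻¹ = g := by group
    rwa [e] at h2
  have hTiff : ∀ n, n ∉ T ↔ x a n ∈ (fun k => 2 * k) '' A b := by
    intro n
    have : x a n = x b (y⁻¹ n) := by simp [hy_def]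
    rw [this, hx b]; rfl
  have hI : (C ∩ T).Infinite := by
    have : (Set.range (fun k : ℕ => (x a)⁻¹ (2 * k + 1))).Infinite :=
      Set.infinite_range_of_injective (fun u v h => by
        have := (x a)⁻¹.injective h
        omega)
    refine this.mono ?_
    rintro _ ⟨k, rfl⟩
    constructor
    · by_contra h
      rw [← hx a, SIP.perm_self_inv] at h
      obtain ⟨l, _, hl⟩ := h
      simp only at hl
      omega
    · by_contra h
      rw [hTiff, SIP.perm_self_inv] at h
      obtain ⟨l, _, hl⟩ := h
      simp only at hl
      omega
  have hU := SIP.gen H C T hC hT hI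
  refine ⟨(C ∪ T)ᶜ, ?_, fun g hg => hU g hg⟩
  refine (((hA2 a b hab).image (fun k => 2 * k)).image ((x a)⁻¹ : Equiv.Perm ℕ)).subset ?_
  intro n hn
  have h1 : n ∉ C := fun h => hn (Or.inl h)
  have h2 : n ∉ T := fun h => hn (Or.inr h)
  rw [← hx a] at h1
  rw [hTiff] at h2
  obtain ⟨k, hk, hk'⟩ := h1
  obtain ⟨l, hl, hl'⟩ := h2
  have : k = l := by simp only at hk' hl'; omega
  subst this
  refine ⟨x a n, ⟨k, ⟨hk, hl⟩, hk'⟩, by simp⟩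
end

section
/- Let H be a subgroup of the group Aut(ℚ,<) of all order-automorphisms of the rational numbers. If the index of H in Aut(ℚ,<) is strictly less than 2^ℵ₀, then there exists a finite set A ⊆ ℚ such that the pointwise stabilizer of A is contained in H. -/
namespace SIP

/-- Automorphisms supported in `S`. -/
def K (S : Set ℚ) : Subgroup (ℚ ≃o ℚ) where
  carrier := {g | ∀ q, q ∉ S → g q = q}
  mul_mem' := by
    intro a b ha hb q hq
    rw [RelIso.mul_apply, hb q hq, ha q hq]
  one_mem' := by
    intro q _
    rfl
  inv_mem' := by
    intro a ha q hq
    have h := ha q hq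
    calc a⁻¹ q = a⁻¹ (a q) := by rw [h]
      _ = q := RelIso.inv_apply_self a q

theorem mem_K {S : Set ℚ} {g : ℚ ≃o ℚ} : g ∈ K S ↔ ∀ q, q ∉ S → g q = q := Iff.rfl

theorem K_mono {S T : Set ℚ} (h : S ⊆ T) : K S ≤ K T :=
  fun _ hg q hq => hg q (fun hs => hq (h hs))

theorem K_map {S : Set ℚ} {g : ℚ ≃o ℚ} (hg : g ∈ K S) {q : ℚ} (hq : q ∈ S) : g q ∈ S := by
  by_contra h
  have h1 := hg _ h
  have h2 : g q = q := g.injective h1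
  rw [h2] at h
  exact h hq

theorem K_conj {S : Set ℚ} {g h : ℚ ≃o ℚ} (hg : g ∈ K S) : h * g * h⁻¹ ∈ K (h '' S) := by
  intro q hq
  have : h⁻¹ q ∉ S := by
    intro hs
    exact hq ⟨_, hs, RelIso.apply_inv_self h q⟩
  rw [RelIso.mul_apply, RelIso.mul_apply, hg _ this]
  exact RelIso.apply_inv_self h q

/-- Small index, in pigeonhole form. -/
def Small (H : Subgroup (ℚ ≃o ℚ)) : Prop :=
  ∀ f : (ℕ → Bool) → (ℚ ≃o ℚ), ∃ x y, x ≠ y ∧ (f x)⁻¹ * f y ∈ H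

theorem small_of_index (H : Subgroup (ℚ ≃o ℚ))
    (hindex : Cardinal.mk ((ℚ ≃o ℚ) ⧸ H) < 2 ^ Cardinal.aleph0) : Small H := by
  intro f
  by_contra hcon
  push Not at hcon
  have hinj : Function.Injective (fun x => (f x : (ℚ ≃o ℚ) ⧸ H)) := by
    intro x y hxy
    by_contra hne
    exact hcon x y hne (QuotientGroup.eq.1 hxy)
  have h1 := Cardinal.mk_le_of_injective hinj
  have h2 : Cardinal.mk (ℕ → Bool) = 2 ^ Cardinal.aleph0 := by simp
  rw [h2] at h1
  exact absurd hindex (not_lt.2 h1)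

theorem Small.comap {H : Subgroup (ℚ ≃o ℚ)} (hH : Small H) (ψ : (ℚ ≃o ℚ) →* (ℚ ≃o ℚ)) :
    Small (H.comap ψ) := by
  intro f
  obtain ⟨x, y, hne, h⟩ := hH (fun x => ψ (f x))
  exact ⟨x, y, hne, by simpa using h⟩

/-- Build an order isomorphism from a strictly monotone map with a right inverse. -/
theorem exists_iso (f f' : ℚ → ℚ) (hf : StrictMono f) (h : ∀ q, f (f' q) = q) :
    ∃ g : ℚ ≃o ℚ, ∀ q, g q = f q :=
  ⟨StrictMono.orderIsoOfRightInverse f hf f' h, fun _ => rfl⟩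

theorem glue_s2 {ι : Type*} (S : ι → Set ℚ) (hS : Pairwise (Function.onFun Disjoint S))
    (g : ι → (ℚ ≃o ℚ)) (hg : ∀ i, g i ∈ K (S i)) :
    ∃ f ∈ K (⋃ i, S i), ∀ i, ∀ q ∈ S i, f q = g i q := by
  classical
  let F : (ι → (ℚ ≃o ℚ)) → ℚ → ℚ := fun g q =>
    if h : ∃ i, q ∈ S i then g h.choose q else q
  have hF1 : ∀ g i q, q ∈ S i → F g q = g i q := by
    intro g i q hq
    have h : ∃ i, q ∈ S i := ⟨i, hq⟩
    have hc := h.choose_spec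
    have : h.choose = i := by
      by_contra hne
      exact Set.disjoint_left.1 (hS hne) hc hq
    simp only [F, dif_pos h, this]
  have hF2 : ∀ g q, (∀ i, q ∉ S i) → F g q = q := by
    intro g q hq
    have h : ¬ ∃ i, q ∈ S i := by simpa using hq
    simp only [F, dif_neg h]
  have hmono : StrictMono (F g) := by
    intro x y hxy
    by_cases hx : ∃ i, x ∈ S i
    · obtain ⟨i, hi⟩ := hx
      rw [hF1 g i x hi]
      by_cases hy : ∃ j, y ∈ S j
      · obtain ⟨j, hj⟩ := hy
        rw [hF1 g j y hj]
        by_cases hij : i = j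
        · subst hij
          exact (g i).lt_iff_lt.2 hxy
        · have hyi : y ∉ S i := fun h => Set.disjoint_left.1 (hS hij) h hj
          have h1 : g i x < y := by
            rw [← hg i y hyi]
            exact (g i).lt_iff_lt.2 hxy
          have h2 : g i x ∉ S j := fun h => Set.disjoint_left.1 (hS hij) (K_map (hg i) hi) h
          rw [← hg j _ h2]
          exact (g j).lt_iff_lt.2 h1
      · have hy' : ∀ j, y ∉ S j := by simpa using hy
        rw [hF2 g y hy', ← hg i y (hy' i)]
        exact (g i).lt_iff_lt.2 hxy
    · have hx' : ∀ j, x ∉ S j := by simpa using hx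
      rw [hF2 g x hx']
      by_cases hy : ∃ j, y ∈ S j
      · obtain ⟨j, hj⟩ := hy
        rw [hF1 g j y hj, ← hg j x (hx' j)]
        exact (g j).lt_iff_lt.2 hxy
      · have hy' : ∀ j, y ∉ S j := by simpa using hy
        rwa [hF2 g y hy']
  have hinv : ∀ q, F g (F (fun i => (g i)⁻¹) q) = q := by
    intro q
    by_cases hx : ∃ i, q ∈ S i
    · obtain ⟨i, hi⟩ := hx
      rw [hF1 (fun i => (g i)⁻¹) i q hi, hF1 g i _ (K_map ((K (S i)).inv_mem (hg i)) hi)]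
      exact RelIso.apply_inv_self (g i) q
    · have hx' : ∀ j, q ∉ S j := by simpa using hx
      rw [hF2 (fun i => (g i)⁻¹) q hx', hF2 g q hx']
  obtain ⟨f, hf⟩ := exists_iso _ _ hmono hinv
  refine ⟨f, ?_, ?_⟩
  · intro q hq
    rw [hf, hF2 g q (by simpa using hq)]
  · intro i q hq
    rw [hf, hF1 g i q hq]

/-- Restriction of `g` to an invariant family of disjoint convex sets. -/
theorem restr {ι : Type*} (S : ι → Set ℚ) (hS : Pairwise (Function.onFun Disjoint S))
    (hc : ∀ i, (S i).OrdConnected) (g : ℚ ≃o ℚ) (hg : ∀ i q, g q ∈ S i ↔ q ∈ S i) :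
    ∃ r ∈ K (⋃ i, S i), ∀ q ∈ ⋃ i, S i, r q = g q := by
  classical
  have h1 : ∀ i, ∃ r ∈ K (S i), ∀ q ∈ S i, r q = g q := by
    intro i
    have hm : ∀ g : ℚ ≃o ℚ, (∀ q, g q ∈ S i ↔ q ∈ S i) →
        StrictMono (fun q => if q ∈ S i then g q else q) := by
      intro g hg x y hxy
      have hlt := g.lt_iff_lt.2 hxy
      by_cases hx : x ∈ S i <;> by_cases hy : y ∈ S i
      · simpa [hx, hy] using hxy
      · simp only [hx, hy, if_true, if_false]
        by_contra hcon
        exact hy ((hc i).out hx ((hg x).2 hx) ⟨hxy.le, not_lt.1 hcon⟩)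
      · simp only [hx, hy, if_true, if_false]
        by_contra hcon
        exact hx ((hc i).out ((hg y).2 hy) hy ⟨not_lt.1 hcon, hxy.le⟩)
      · simpa [hx, hy] using hxy
    obtain ⟨r, hr⟩ := exists_iso _ (fun q => if q ∈ S i then g⁻¹ q else q) (hm g (hg i)) (by
      intro q
      by_cases hq : q ∈ S i
      · have : g⁻¹ q ∈ S i := by
          rw [← hg i, RelIso.apply_inv_self]
          exact hq
        simp only [hq, if_true, this]
        exact RelIso.apply_inv_self g q
      · simp [hq])
    refine ⟨r, ?_, ?_⟩
    · intro q hq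
      rw [hr, if_neg hq]
    · intro q hq
      rw [hr, if_pos hq]
  choose r hr hr' using h1
  obtain ⟨f, hf, hf'⟩ := glue_s2 S hS r hr
  refine ⟨f, hf, ?_⟩
  intro q hq
  obtain ⟨i, hi⟩ := Set.mem_iUnion.1 hq
  rw [hf' i q hi, hr' i q hi]

/-- Fullness. -/
theorem full_s2 {H : Subgroup (ℚ ≃o ℚ)} (hH : Small H) (S : ℕ → Set ℚ)
    (hS : Pairwise (Function.onFun Disjoint S)) :
    ∃ n, ∀ k ∈ K (S n), ∃ h ∈ H, h ∈ K (⋃ i, S i) ∧ ∀ q ∈ S n, h q = k q := by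
  by_contra hcon
  push Not at hcon
  choose k hk hbad using hcon
  have h1 : ∀ x : ℕ → Bool, ∃ f ∈ K (⋃ i, S i), ∀ i, ∀ q ∈ S i,
      f q = (if x i then k i else 1 : ℚ ≃o ℚ) q := by
    intro x
    apply glue_s2 S hS
    intro i
    split_ifs
    · exact hk i
    · exact (K (S i)).one_mem
  choose f hf hf' using h1
  have key : ∀ x y : ℕ → Bool, (f x)⁻¹ * f y ∈ H → ∀ n, ¬ (x n = false ∧ y n = true) := by
    rintro x y hxy n ⟨hx, hy⟩
    obtain ⟨q, hq, hne⟩ := hbad n _ hxy ((K _).mul_mem ((K _).inv_mem (hf x)) (hf y))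
    apply hne
    rw [RelIso.mul_apply, hf' y n q hq]
    simp only [hy, if_true]
    have h2 : f x (k n q) = k n q := by
      rw [hf' x n _ (K_map (hk n) hq)]
      simp [hx]
    calc (f x)⁻¹ (k n q) = (f x)⁻¹ (f x (k n q)) := by rw [h2]
      _ = _ := RelIso.inv_apply_self _ _
  obtain ⟨x, y, hne, hxy⟩ := hH f
  obtain ⟨n, hn⟩ := Function.ne_iff.1 hne
  have hyx : (f y)⁻¹ * f x ∈ H := by
    have := H.inv_mem hxy
    simpa using this
  have a := key x y hxy n
  have b := key y x hyx n
  cases hx : x n <;> cases hy : y n <;> simp_all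

theorem conj_eq {S : Set ℚ} {h t m : ℚ ≃o ℚ} (hm : m ∈ K S) (heq : ∀ q ∈ S, h q = t q) :
    h * m * h⁻¹ = t * m * t⁻¹ := by
  have hc : ∀ q ∈ S, (t⁻¹ * h) q = q := by
    intro q hq
    rw [RelIso.mul_apply, heq q hq, RelIso.inv_apply_self]
  generalize hcdef : t⁻¹ * h = c at hc
  have hh : h = t * c := by rw [← hcdef]; group
  have hcomm : c * m = m * c := by
    ext q
    rw [RelIso.mul_apply, RelIso.mul_apply]
    by_cases hq : q ∈ S
    · rw [hc _ (K_map hm hq), hc _ hq]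
    · have : c q ∉ S := by
        intro hs
        have h1 := hc _ hs
        have h2 := c.injective h1
        rw [h2] at hs
        exact hq hs
      rw [hm _ this, hm _ hq]
  rw [hh]
  calc t * c * m * (t * c)⁻¹ = t * (c * m) * c⁻¹ * t⁻¹ := by group
    _ = t * m * t⁻¹ := by rw [hcomm]; group

/-- The swindle: an element supported on a displaceable set is a commutator. -/
theorem swindle {C C' : Set ℚ} (hsub : C' ⊆ C) {t : ℚ ≃o ℚ} (ht : t ∈ K C)
    (hd : ∀ m : ℕ, m ≠ 0 → ∀ q ∈ C', (t ^ m) q ∉ C') {f : ℚ ≃o ℚ} (hf : f ∈ K C') :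
    ∃ F ∈ K C, f = F * t * F⁻¹ * t⁻¹ := by
  have hdisj : Pairwise (Function.onFun Disjoint (fun m : ℕ => (t ^ m) '' C')) := by
    have h1 : ∀ a b : ℕ, a < b → Disjoint ((t ^ a) '' C') ((t ^ b) '' C') := by
      intro a b hab
      rw [Set.disjoint_left]
      rintro _ ⟨x, hx, rfl⟩ ⟨y, hy, hxy⟩
      obtain ⟨c, rfl⟩ := Nat.exists_eq_add_of_lt hab
      have h2 : t ^ (a + c + 1) = t ^ a * t ^ (c + 1) := by rw [← pow_add]; congr 1
      rw [h2, RelIso.mul_apply] at hxy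
      have := (t ^ a).injective hxy
      exact hd (c + 1) (by omega) y hy (this ▸ hx)
    intro a b hab
    rcases lt_or_gt_of_ne hab with h | h
    · exact h1 a b h
    · exact (h1 b a h).symm
  obtain ⟨F, hF, hF'⟩ := glue_s2 _ hdisj (fun m => t ^ m * f * (t ^ m)⁻¹) (fun m => K_conj hf)
  refine ⟨F, ?_, ?_⟩
  · refine K_mono ?_ hF
    apply Set.iUnion_subset
    rintro m _ ⟨x, hx, rfl⟩
    exact K_map ((K C).pow_mem ht m) (hsub hx)
  · suffices h : f * (t * F * t⁻¹) = F by
      nth_rewrite 1 [← h]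
      group
    ext q
    simp only [RelIso.mul_apply]
    by_cases hq : ∃ m : ℕ, q ∈ (t ^ m) '' C'
    · obtain ⟨m, hm⟩ := hq
      rcases m with _ | m
      · have hq0 : q ∈ C' := by simpa using hm
        have hn : t⁻¹ q ∉ ⋃ m : ℕ, (t ^ m) '' C' := by
          intro h
          obtain ⟨m, x, hx, hxm⟩ := Set.mem_iUnion.1 h
          apply hd (m + 1) (by omega) x hx
          rw [pow_succ', RelIso.mul_apply, hxm, RelIso.apply_inv_self]
          exact hq0
        rw [hF _ hn, RelIso.apply_inv_self, hF' 0 q hm]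
        simp
      · obtain ⟨x, hx, rfl⟩ := hm
        have h1 : t⁻¹ ((t ^ (m + 1)) x) = (t ^ m) x := by
          rw [pow_succ', RelIso.mul_apply, RelIso.inv_apply_self]
        rw [h1, hF' m _ ⟨x, hx, rfl⟩, hF' (m + 1) _ ⟨x, hx, rfl⟩]
        simp only [RelIso.mul_apply, RelIso.inv_apply_self]
        rw [← RelIso.mul_apply t, ← pow_succ']
        exact hf _ (hd (m + 1) (by omega) _ (K_map hf hx))
    · have hn : q ∉ ⋃ m : ℕ, (t ^ m) '' C' := by simpa using hq
      have hn' : t⁻¹ q ∉ ⋃ m : ℕ, (t ^ m) '' C' := by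
        intro h
        obtain ⟨m, x, hx, hxm⟩ := Set.mem_iUnion.1 h
        apply hn
        refine Set.mem_iUnion.2 ⟨m + 1, x, hx, ?_⟩
        rw [pow_succ', RelIso.mul_apply, hxm, RelIso.apply_inv_self]
      rw [hF _ hn, hF _ hn', RelIso.apply_inv_self]
      apply hf
      intro h
      exact hn (Set.mem_iUnion.2 ⟨0, by simpa using h⟩)

theorem mainA {H : Subgroup (ℚ ≃o ℚ)} (hH : Small H) (C C' : ℕ × ℕ → Set ℚ)
    (hC : Pairwise (Function.onFun Disjoint C)) (hsub : ∀ k, C' k ⊆ C k)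
    (t : ℕ × ℕ → (ℚ ≃o ℚ)) (ht : ∀ k, t k ∈ K (C k))
    (hd : ∀ k, ∀ m : ℕ, m ≠ 0 → ∀ q ∈ C' k, (t k ^ m) q ∉ C' k) :
    ∃ k, K (C' k) ≤ H := by
  have hS : Pairwise (Function.onFun Disjoint (fun n : ℕ => ⋃ i : ℕ, C (n, i))) := by
    intro a b hab
    simp only [Function.onFun, Set.disjoint_iUnion_left, Set.disjoint_iUnion_right]
    intro i j
    exact hC (by simp [hab])
  obtain ⟨n, hn⟩ := full_s2 hH _ hS
  have hS' : Pairwise (Function.onFun Disjoint (fun i : ℕ => C (n, i))) := by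
    intro a b hab
    exact hC (by simp [hab])
  obtain ⟨i, hi⟩ := full_s2 hH _ hS'
  refine ⟨(n, i), ?_⟩
  intro f hf
  obtain ⟨F, hF, rfl⟩ := swindle (hsub _) (ht (n, i)) (hd (n, i)) hf
  obtain ⟨h, hhH, hhK, hh⟩ := hi F hF
  have htS : t (n, i) ∈ K (⋃ i : ℕ, C (n, i)) :=
    K_mono (Set.subset_iUnion (fun i : ℕ => C (n, i)) i) (ht (n, i))
  obtain ⟨h', hhH', -, hh'⟩ := hn _ htS
  rw [← conj_eq (ht (n, i)) hh]
  have h2 := conj_eq ((K _).inv_mem hhK) hh'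
  have h3 : h * t (n, i) * h⁻¹ * (t (n, i))⁻¹ = h * (h' * h⁻¹ * h'⁻¹) := by
    rw [h2]; group
  rw [h3]
  exact H.mul_mem hhH (H.mul_mem (H.mul_mem hhH' (H.inv_mem hhH)) (H.inv_mem hhH'))

theorem glue_pow {C : Set ℚ} {v u : ℚ ≃o ℚ} (hu : u ∈ K C) (h : ∀ q ∈ C, v q = u q) (m : ℕ) :
    ∀ q ∈ C, (v ^ m) q = (u ^ m) q := by
  induction m with
  | zero => intro q _; rfl
  | succ m ih =>
    intro q hq
    rw [pow_succ, pow_succ, RelIso.mul_apply, RelIso.mul_apply, h q hq, ih _ (K_map hu hq)]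

theorem mainA' {H : Subgroup (ℚ ≃o ℚ)} (hH : Small H) {ι : Type*} (W W' : ι → Set ℚ)
    (hW : Pairwise (Function.onFun Disjoint W)) (hsub : ∀ k, W' k ⊆ W k)
    (v : ι → (ℚ ≃o ℚ)) (hv : ∀ k, v k ∈ K (W k))
    (hd : ∀ k, ∀ m : ℕ, m ≠ 0 → ∀ q ∈ W' k, (v k ^ m) q ∉ W' k) (code : ι → ℕ) :
    ∃ k, K (⋃ i : {i // code i = k}, W' i) ≤ H := by
  have hW2 : ∀ k, Pairwise (Function.onFun Disjoint (fun i : {i // code i = k} => W i)) := by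
    intro k a b hab
    exact hW (fun h => hab (Subtype.ext h))
  have hg : ∀ k : ℕ, ∃ f ∈ K (⋃ i : {i // code i = k}, W i),
      ∀ i : {i // code i = k}, ∀ q ∈ W i, f q = v i q := fun k =>
    glue_s2 (fun i : {i // code i = k} => W i) (hW2 k) (fun i => v i) (fun i => hv i)
  choose t ht ht' using hg
  obtain ⟨k, hk⟩ := mainA hH (fun p => ⋃ i : {i // code i = Nat.pair p.1 p.2}, W i)
    (fun p => ⋃ i : {i // code i = Nat.pair p.1 p.2}, W' i) (by
      intro a b hab
      simp only [Function.onFun, Set.disjoint_iUnion_left, Set.disjoint_iUnion_right]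
      rintro ⟨i, hi⟩ ⟨j, hj⟩
      apply hW
      rintro rfl
      apply hab
      rw [hi] at hj
      have := Nat.pair_eq_pair.1 hj
      exact Prod.ext this.1.symm this.2.symm)
    (fun p => Set.iUnion_mono (fun i => hsub i)) (fun p => t (Nat.pair p.1 p.2))
    (fun p => ht _) (by
      intro p m hm q hq hq'
      obtain ⟨i, hi⟩ := Set.mem_iUnion.1 hq
      obtain ⟨j, hj⟩ := Set.mem_iUnion.1 hq'
      rw [glue_pow (hv i) (ht' _ i) m q (hsub _ hi)] at hj
      have h1 := K_map ((K _).pow_mem (hv i) m) (hsub _ hi)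
      have hij : i = j := by
        by_contra hne
        exact Set.disjoint_left.1 (hW2 _ hne) h1 (hsub _ hj)
      subst hij
      exact hd i m hm q hi hj)
  exact ⟨_, hk⟩

end SIP

namespace SIP

/-- The binary code of an initial segment. -/
def pre (x : ℕ → Bool) : ℕ → ℕ
  | 0 => 0
  | n + 1 => 2 * pre x n + (x n).toNat

theorem pre_lt (x : ℕ → Bool) (n : ℕ) : pre x n < 2 ^ n := by
  induction n with
  | zero => simp [pre]
  | succ n ih =>
    have := Bool.toNat_lt (x n)
    rw [pre, pow_succ]
    omega

theorem pre_inj (x y : ℕ → Bool) (n : ℕ) (h : pre x n = pre y n) : ∀ m < n, x m = y m := by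
  induction n with
  | zero => intro m hm; omega
  | succ n ih =>
    have h1 := Bool.toNat_lt (x n)
    have h2 := Bool.toNat_lt (y n)
    rw [pre, pre] at h
    have h3 : (x n).toNat = (y n).toNat := by omega
    have h4 : pre x n = pre y n := by omega
    intro m hm
    rcases Nat.lt_succ_iff_lt_or_eq.1 hm with h | h
    · exact ih h4 m h
    · subst h
      cases hx : x m <;> cases hy : y m <;> simp_all

theorem spread {H : Subgroup (ℚ ≃o ℚ)} (hH : Small H) (E D' D : ℕ → Set ℚ)
    (hE : Pairwise (Function.onFun Disjoint E)) (t u : ℕ → (ℚ ≃o ℚ))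
    (ht : ∀ n, t n ∈ K (E n)) (hDE : ∀ n, D' n ⊆ E n) (hDD : ∀ n, D n ⊆ D' n)
    (htd : ∀ n, ∀ j : ℤ, j ≠ 0 → ∀ q ∈ D' n, (t n ^ j) q ∉ D' n)
    (hu : ∀ n, u n ∈ K (D' n))
    (hud : ∀ n, ∀ m : ℕ, m ≠ 0 → ∀ q ∈ D n, (u n ^ m) q ∉ D n) :
    ∃ n0, K (⋃ n : {n : ℕ // n0 ≤ n}, D n) ≤ H := by
  have hsubE : ∀ n (j : ℤ), (t n ^ j) '' D' n ⊆ E n := by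
    rintro n j _ ⟨x, hx, rfl⟩
    exact K_map ((K _).zpow_mem (ht n) j) (hDE n hx)
  obtain ⟨k, hk⟩ := mainA' hH (ι := ℕ × ℤ) (fun p => (t p.1 ^ p.2) '' D' p.1)
    (fun p => (t p.1 ^ p.2) '' D p.1) (by
      rintro ⟨n, i⟩ ⟨m, j⟩ hne
      by_cases hnm : n = m
      · subst hnm
        have hij : i ≠ j := by
          rintro rfl
          exact hne rfl
        simp only [Function.onFun]
        rw [Set.disjoint_left]
        rintro _ ⟨x, hx, rfl⟩ ⟨y, hy, hxy⟩
        change (t n ^ j) y = (t n ^ i) x at hxy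
        apply htd n (j - i) (sub_ne_zero.2 hij.symm) y hy
        have : t n ^ (j - i) = (t n ^ i)⁻¹ * t n ^ j := by
          rw [← zpow_neg, ← zpow_add]; congr 1; ring
        rw [this, RelIso.mul_apply, hxy, RelIso.inv_apply_self]
        exact hx
      · exact Set.disjoint_of_subset (hsubE n i) (hsubE m j) (hE hnm))
    (fun p => Set.image_mono (hDD _))
    (fun p => t p.1 ^ p.2 * u p.1 * (t p.1 ^ p.2)⁻¹) (fun p => K_conj (hu _)) (by
      rintro ⟨n, j⟩ m hm _ ⟨x, hx, rfl⟩ ⟨y, hy, hxy⟩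
      simp only at hx hy hxy
      rw [conj_pow, RelIso.mul_apply, RelIso.mul_apply, RelIso.inv_apply_self] at hxy
      have := (t n ^ j).injective hxy
      exact hud n m hm x hx (this ▸ hy))
    (fun p => Nat.log (2 ^ (p.1 + 1)) p.2.natAbs)
  have hf : ∀ x : ℕ → Bool, ∃ f ∈ K (⋃ n, E n), ∀ n, ∀ q ∈ E n,
      f q = (t n ^ (((pre x n) * (2 ^ (n + 1)) ^ k : ℕ) : ℤ)) q := by
    intro x
    exact glue_s2 E hE _ (fun n => (K _).zpow_mem (ht n) _)
  choose f _ hf' using hf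
  obtain ⟨x, y, hne, hxy⟩ := hH f
  obtain ⟨m, hm⟩ := Function.ne_iff.1 hne
  refine ⟨m + 1, ?_⟩
  intro g hg
  set h := (f x)⁻¹ * f y with hh
  have key : h * g * h⁻¹ ∈ H := by
    apply hk
    refine K_mono ?_ (K_conj hg)
    rintro _ ⟨q, hq, rfl⟩
    obtain ⟨⟨n, hn⟩, hqn⟩ := Set.mem_iUnion.1 hq
    simp only at hqn
    have hqE : q ∈ E n := hDE n (hDD n hqn)
    set B : ℕ := 2 ^ (n + 1) with hB
    set j : ℤ := ((pre y n * B ^ k : ℕ) : ℤ) - ((pre x n * B ^ k : ℕ) : ℤ) with hj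
    have hval : h q = (t n ^ j) q := by
      have h1 : (t n ^ j) q ∈ E n := K_map ((K _).zpow_mem (ht n) j) hqE
      have h2 : f x ((t n ^ j) q) = f y q := by
        rw [hf' x n _ h1, hf' y n _ hqE, ← RelIso.mul_apply, ← zpow_add]
        congr 2
        rw [hj]; ring
      rw [hh, RelIso.mul_apply, ← h2, RelIso.inv_apply_self]
    have hcode : Nat.log B j.natAbs = k := by
      have hx := pre_lt x n
      have hy := pre_lt y n
      have hne' : pre x n ≠ pre y n := fun h => hm (pre_inj x y n h m (by omega))
      have hB2 : 2 ^ n < B := by rw [hB]; exact Nat.pow_lt_pow_right (by norm_num) (by omega)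
      have hj2 : j.natAbs = ((pre y n : ℤ) - pre x n).natAbs * B ^ k := by
        rw [hj]
        push_cast
        rw [← sub_mul, Int.natAbs_mul]
        congr 1
      rw [hj2]
      apply Nat.log_eq_of_pow_le_of_lt_pow
      · apply Nat.le_mul_of_pos_left
        omega
      · rw [pow_succ, mul_comm]
        apply Nat.mul_lt_mul_of_pos_left
        · omega
        · positivity
    refine Set.mem_iUnion.2 ⟨⟨(n, j), hcode⟩, ?_⟩
    exact ⟨q, hqn, hval.symm⟩
  have := H.mul_mem (H.mul_mem (H.inv_mem hxy) key) hxy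
  have e : h⁻¹ * (h * g * h⁻¹) * h = g := by group
  rwa [e] at this

/-- Maximum of two order isomorphisms. -/
theorem exists_sup (f g : ℚ ≃o ℚ) : ∃ r : ℚ ≃o ℚ, ∀ q, r q = max (f q) (g q) := by
  apply exists_iso (fun q => max (f q) (g q)) (fun q => min (f.symm q) (g.symm q))
  · intro x y hxy
    exact max_lt_max (f.lt_iff_lt.2 hxy) (g.lt_iff_lt.2 hxy)
  · intro q
    rcases le_total (f.symm q) (g.symm q) with h | h
    · rw [min_eq_left h]
      have : g (f.symm q) ≤ q := by rw [← g.le_symm_apply]; exact h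
      simp [this]
    · rw [min_eq_right h]
      have : f (g.symm q) ≤ q := by rw [← f.le_symm_apply]; exact h
      simp [this]

theorem exists_inf (f g : ℚ ≃o ℚ) : ∃ r : ℚ ≃o ℚ, ∀ q, r q = min (f q) (g q) := by
  apply exists_iso (fun q => min (f q) (g q)) (fun q => max (f.symm q) (g.symm q))
  · intro x y hxy
    exact min_lt_min (f.lt_iff_lt.2 hxy) (g.lt_iff_lt.2 hxy)
  · intro q
    rcases le_total (f.symm q) (g.symm q) with h | h
    · rw [max_eq_right h]
      have : q ≤ f (g.symm q) := by rw [← f.symm_apply_le]; exact h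
      simp [this]
    · rw [max_eq_left h]
      have : q ≤ g (f.symm q) := by rw [← g.symm_apply_le]; exact h
      simp [this]

theorem exists_lin (a α c : ℚ) (hα : 0 < α) : ∃ r : ℚ ≃o ℚ, ∀ q, r q = c + (q - a) * α := by
  apply exists_iso (fun q => c + (q - a) * α) (fun q => (q - c) / α + a)
  · intro x y hxy
    have := mul_lt_mul_of_pos_right (sub_lt_sub_right hxy a) hα
    simp only
    linarith
  · intro q
    field_simp
    ring

/-- Moving a point up inside an interval. -/
theorem exists_move_up {a c d b : ℚ} (hac : a < c) (hcd : c ≤ d) (hdb : d < b) :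
    ∃ t ∈ K (Set.Ioo a b), t c = d ∧ ∀ q, q ≤ t q := by
  have hα : 1 ≤ (d - a) / (c - a) := by rw [one_le_div (by linarith)]; linarith
  have hβ : (b - d) / (b - c) ≤ 1 := by rw [div_le_one (by linarith)]; linarith
  have hα' : c - a ≠ 0 := by linarith
  have hβ' : b - c ≠ 0 := by linarith
  have hβ0 : 0 < (b - d) / (b - c) := div_pos (by linarith) (by linarith)
  have e1 : a + (c - a) * ((d - a) / (c - a)) = d := by field_simp; ring
  have e2 : b + (c - b) * ((b - d) / (b - c)) = d := by
    have : (c - b) = -(b - c) := by ring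
    rw [this]; field_simp; ring
  generalize (d - a) / (c - a) = α at *
  generalize (b - d) / (b - c) = β at *
  obtain ⟨f, hf⟩ := exists_lin a α a (by linarith)
  obtain ⟨g, hg⟩ := exists_lin b β b (by linarith)
  obtain ⟨r, hr⟩ := exists_inf f g
  obtain ⟨s, hs⟩ := exists_sup 1 r
  have hs' : ∀ q, s q = max q (min (a + (q - a) * α) (b + (q - b) * β)) := by
    intro q
    rw [hs, hr, hf, hg]
    rfl
  refine ⟨s, ?_, ?_, ?_⟩
  · intro q hq
    rw [hs']
    apply max_eq_left
    by_cases h : q ≤ a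
    · apply min_le_of_left_le
      nlinarith
    · have : b ≤ q := by
        by_contra hb
        exact hq ⟨not_le.1 h, not_le.1 hb⟩
      apply min_le_of_right_le
      nlinarith
  · rw [hs', e1, e2, min_self, max_eq_right hcd]
  · intro q
    rw [hs']
    exact le_max_left _ _

theorem exists_move {a c d b : ℚ} (hac : a < c) (hcb : c < b) (had : a < d) (hdb : d < b) :
    ∃ t ∈ K (Set.Ioo a b), t c = d := by
  rcases le_total c d with h | h
  · obtain ⟨t, ht, h1, -⟩ := exists_move_up hac h hdb
    exact ⟨t, ht, h1⟩
  · obtain ⟨t, ht, h1, -⟩ := exists_move_up had h hcb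
    refine ⟨t⁻¹, (K _).inv_mem ht, ?_⟩
    rw [← h1, RelIso.inv_apply_self]

theorem exists_disp {a c d b : ℚ} (hac : a < c) (hcd : c < d) (hdb : d < b) :
    ∃ t ∈ K (Set.Ioo a b), ∀ j : ℤ, j ≠ 0 → ∀ q ∈ Set.Ico c d, (t ^ j) q ∉ Set.Ico c d := by
  obtain ⟨t, ht, h1, h2⟩ := exists_move_up hac hcd.le hdb
  refine ⟨t, ht, ?_⟩
  have hp : ∀ m : ℕ, ∀ q, q ≤ (t ^ m) q := by
    intro m
    induction m with
    | zero => intro q; exact le_rfl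
    | succ m ih =>
      intro q
      rw [pow_succ, RelIso.mul_apply]
      exact (h2 q).trans (ih _)
  have hp' : ∀ m : ℕ, m ≠ 0 → ∀ q ∈ Set.Ico c d, (t ^ m) q ∉ Set.Ico c d := by
    intro m hm q hq hq'
    obtain ⟨m, rfl⟩ := Nat.exists_eq_succ_of_ne_zero hm
    rw [Nat.succ_eq_add_one, pow_succ, RelIso.mul_apply] at hq'
    have := hp m (t q)
    have h3 : t c ≤ t q := t.le_iff_le.2 hq.1
    rw [h1] at h3
    exact absurd hq'.2 (not_lt.2 (h3.trans this))
  intro j hj q hq hq'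
  rcases lt_or_gt_of_ne hj with h | h
  · obtain ⟨m, hm⟩ := Int.eq_ofNat_of_zero_le (a := -j) (by omega)
    apply hp' m (by omega) _ hq'
    rw [← zpow_natCast, ← hm, ← RelIso.mul_apply, ← zpow_add]
    simpa using hq
  · obtain ⟨m, hm⟩ := Int.eq_ofNat_of_zero_le (a := j) (by omega)
    apply hp' m (by omega) _ hq
    rwa [← zpow_natCast, ← hm]

theorem seq_gap {l r : ℕ → ℚ} (c : ℚ) (hc : 0 ≤ c) (hlr : ∀ n, l n < r n)
    (hg : ∀ n, r n + c < l (n + 1)) : ∀ m n, m < n → r m + c < l n := by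
  intro m n hmn
  induction n with
  | zero => omega
  | succ n ih =>
    rcases Nat.lt_succ_iff_lt_or_eq.1 hmn with h | h
    · linarith [ih h, hlr n, hg n]
    · subst h
      exact hg m

theorem pairwise_disj {l r : ℕ → ℚ} (S : ℕ → Set ℚ) (c : ℚ) (h : ∀ m n, m < n → r m + c < l n)
    (hS : ∀ n, ∀ q ∈ S n, l n - c / 2 ≤ q ∧ q ≤ r n + c / 2) :
    Pairwise (Function.onFun Disjoint S) := by
  have h1 : ∀ a b : ℕ, a < b → Disjoint (S a) (S b) := by
    intro a b hab
    rw [Set.disjoint_left]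
    intro q hq hq'
    linarith [(hS a q hq).2, (hS b q hq').1, h a b hab]
  intro a b hab
  rcases lt_or_gt_of_ne hab with h | h
  · exact h1 a b h
  · exact (h1 b a h).symm

theorem discrete {H : Subgroup (ℚ ≃o ℚ)} (hH : Small H) (l r : ℕ → ℚ) (hlr : ∀ n, l n < r n)
    (hg : ∀ n, r n + 2 < l (n + 1)) :
    ∃ n0, K (⋃ n : {n : ℕ // n0 ≤ n}, Set.Ico (l n) (r n)) ≤ H := by
  have ht : ∀ n, ∃ t ∈ K (Set.Ioo (l n - 1) (r n + 1)), ∀ j : ℤ, j ≠ 0 →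
      ∀ q ∈ Set.Ico (l n - 1 / 2) (r n + 1 / 2), (t ^ j) q ∉ Set.Ico (l n - 1 / 2) (r n + 1 / 2) :=
    fun n => exists_disp (by linarith) (by linarith [hlr n]) (by linarith)
  have hu : ∀ n, ∃ t ∈ K (Set.Ioo (l n - 1 / 2) (r n + 1 / 2)), ∀ j : ℤ, j ≠ 0 →
      ∀ q ∈ Set.Ico (l n) (r n), (t ^ j) q ∉ Set.Ico (l n) (r n) :=
    fun n => exists_disp (by linarith) (hlr n) (by linarith)
  choose t ht htd using ht
  choose u hu hud using hu
  refine spread hH (fun n => Set.Ioo (l n - 1) (r n + 1))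
    (fun n => Set.Ico (l n - 1 / 2) (r n + 1 / 2)) (fun n => Set.Ico (l n) (r n)) ?_ t u ht ?_ ?_
    htd ?_ ?_
  · refine pairwise_disj _ 2 (seq_gap 2 (by norm_num) hlr hg) ?_
    intro n q hq
    have := hq.1
    have := hq.2
    constructor <;> linarith
  · intro n q hq
    exact ⟨by linarith [hq.1], by linarith [hq.2]⟩
  · intro n q hq
    exact ⟨by linarith [hq.1], by linarith [hq.2]⟩
  · intro n
    exact K_mono Set.Ioo_subset_Ico_self (hu n)
  · intro n m hm q hq
    have := hud n m (by exact_mod_cast hm) q hq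
    rwa [zpow_natCast] at this

theorem bounded_part {H : Subgroup (ℚ ≃o ℚ)} (hH : Small H) :
    ∃ b : ℚ, ∀ c, K (Set.Ioo b c) ≤ H := by
  by_contra hcon
  push Not at hcon
  choose c hc using hcon
  have hbc : ∀ b, b < c b := by
    intro b
    by_contra h
    apply hc b
    rw [Set.Ioo_eq_empty h]
    intro g hg
    have : g = 1 := by
      ext q
      exact hg q (by simp)
    rw [this]
    exact H.one_mem
  let l : ℕ → ℚ := fun n => (fun b => c b + 3)^[n] 0
  have hl : ∀ n, l (n + 1) = c (l n) + 3 := by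
    intro n
    simp only [l, Function.iterate_succ_apply']
  have hu : ∀ n, ∃ t ∈ K (Set.Ioo (l n - 1) (c (l n) + 1)), ∀ j : ℤ, j ≠ 0 →
      ∀ q ∈ Set.Ico (l n) (c (l n)), (t ^ j) q ∉ Set.Ico (l n) (c (l n)) :=
    fun n => exists_disp (by linarith) (hbc _) (by linarith)
  choose u hu hud using hu
  obtain ⟨k, hk⟩ := mainA' hH (fun n => Set.Ioo (l n - 1) (c (l n) + 1))
    (fun n => Set.Ico (l n) (c (l n))) (by
      refine pairwise_disj (l := l) (r := fun n => c (l n)) _ 2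
        (seq_gap 2 (by norm_num) (fun n => hbc _) (fun n => by rw [hl]; linarith)) ?_
      intro n q hq
      have := hq.1
      have := hq.2
      constructor <;> linarith) (by
      intro n q hq
      exact ⟨by linarith [hq.1], by linarith [hq.2]⟩) u hu (by
      intro n m hm q hq
      have := hud n m (by exact_mod_cast hm) q hq
      rwa [zpow_natCast] at this) id
  apply hc (l k)
  refine le_trans (K_mono ?_) hk
  intro q hq
  exact Set.mem_iUnion.2 ⟨⟨k, rfl⟩, hq.1.le, hq.2⟩

end SIP

namespace SIP

theorem peel {H : Subgroup (ℚ ≃o ℚ)} (hH : Small H) (g : ℚ ≃o ℚ) (z : ℕ → ℚ)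
    (hz : ∀ n, z n + 10 ≤ z (n + 1)) (n0 : ℕ) (hfix : ∀ n, n0 ≤ n → g (z n) = z n) (ε : ℕ) :
    ∃ N, ∃ r ∈ H, (∀ q, (r⁻¹ * g) q = q ∨ (r⁻¹ * g) q = g q) ∧
      ∀ n, N ≤ n → ∀ q ∈ Set.Ico (z (2 * n + ε)) (z (2 * n + ε + 1)), (r⁻¹ * g) q = q := by
  have hlr : ∀ n, z (2 * n + ε) < z (2 * n + ε + 1) := fun n => by linarith [hz (2 * n + ε)]
  have hgap : ∀ n, z (2 * n + ε + 1) + 2 < z (2 * (n + 1) + ε) := by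
    intro n
    have e : 2 * (n + 1) + ε = 2 * n + ε + 1 + 1 := by ring
    rw [e]
    linarith [hz (2 * n + ε + 1)]
  obtain ⟨n1, hn1⟩ := discrete hH (fun n => z (2 * n + ε)) (fun n => z (2 * n + ε + 1)) hlr hgap
  have hpd : Pairwise (Function.onFun Disjoint
      (fun n => Set.Ico (z (2 * n + ε)) (z (2 * n + ε + 1)))) := by
    refine pairwise_disj (l := fun n => z (2 * n + ε)) (r := fun n => z (2 * n + ε + 1)) _ 2
      (seq_gap 2 (by norm_num) hlr hgap) ?_
    intro n q hq
    have := hq.1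
    have := hq.2
    constructor <;> linarith
  let N := max n0 n1
  have hinv : ∀ (i : {n : ℕ // N ≤ n}) q, g q ∈ Set.Ico (z (2 * i + ε)) (z (2 * i + ε + 1)) ↔
      q ∈ Set.Ico (z (2 * i + ε)) (z (2 * i + ε + 1)) := by
    rintro ⟨i, hi⟩ q
    have hi0 : n0 ≤ i := le_trans (le_max_left _ _) hi
    have h1 := hfix (2 * i + ε) (by omega)
    have h2 := hfix (2 * i + ε + 1) (by omega)
    simp only [Set.mem_Ico]
    conv_lhs => rw [← h1, ← h2]
    rw [g.le_iff_le, g.lt_iff_lt]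
  obtain ⟨r, hr, hr'⟩ := restr (fun i : {n : ℕ // N ≤ n} =>
    Set.Ico (z (2 * i + ε)) (z (2 * i + ε + 1))) (by
      intro a b hab
      exact hpd (fun h => hab (Subtype.ext h))) (fun i => Set.ordConnected_Ico) g hinv
  have hfixU : ∀ q ∈ ⋃ i : {n : ℕ // N ≤ n}, Set.Ico (z (2 * i + ε)) (z (2 * i + ε + 1)),
      (r⁻¹ * g) q = q := by
    intro q hq
    rw [RelIso.mul_apply, ← hr' q hq, RelIso.inv_apply_self]
  refine ⟨N, r, ?_, ?_, ?_⟩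
  · apply hn1
    refine K_mono ?_ hr
    apply Set.iUnion_subset
    rintro ⟨i, hi⟩ q hq
    exact Set.mem_iUnion.2 ⟨⟨i, le_trans (le_max_right _ _) hi⟩, hq⟩
  · intro q
    by_cases hq : q ∈ ⋃ i : {n : ℕ // N ≤ n}, Set.Ico (z (2 * i + ε)) (z (2 * i + ε + 1))
    · exact Or.inl (hfixU q hq)
    · right
      rw [RelIso.mul_apply]
      apply (K _).inv_mem hr
      intro h
      obtain ⟨i, hi⟩ := Set.mem_iUnion.1 h
      exact hq (Set.mem_iUnion.2 ⟨i, (hinv i q).1 hi⟩)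
  · intro n hn q hq
    exact hfixU q (Set.mem_iUnion.2 ⟨⟨n, hn⟩, hq⟩)

theorem step1 {H : Subgroup (ℚ ≃o ℚ)} (hH : Small H) : ∃ b : ℚ, K (Set.Ioi b) ≤ H := by
  obtain ⟨b, hb⟩ := bounded_part hH
  refine ⟨b, ?_⟩
  intro g hg
  have hgi : ∀ s w : ℚ, g⁻¹ s ≤ w → s ≤ g w := by
    intro s w h
    have := g.le_iff_le.2 h
    rwa [RelIso.apply_inv_self] at this
  let z : ℕ → ℚ := fun n =>
    (fun w => max (max w (g w) + 10) (g⁻¹ (max w (g w) + 10)))^[n] (max (b + 5) (g⁻¹ (b + 5)))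
  have hz0 : z 0 = max (b + 5) (g⁻¹ (b + 5)) := rfl
  have hzs : ∀ n, z (n + 1) =
      max (max (z n) (g (z n)) + 10) (g⁻¹ (max (z n) (g (z n)) + 10)) := by
    intro n
    simp only [z, Function.iterate_succ_apply']
  have hA : ∀ n, max (z n) (g (z n)) + 10 ≤ z (n + 1) := by
    intro n
    rw [hzs]
    exact le_max_left _ _
  have hB : ∀ n, max (z n) (g (z n)) + 10 ≤ g (z (n + 1)) := by
    intro n
    apply hgi
    rw [hzs n]
    exact le_max_right _ _
  have hA0 : b + 5 ≤ z 0 := le_max_left _ _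
  have hB0 : b + 5 ≤ g (z 0) := hgi _ _ (le_max_right _ _)
  have hz : ∀ n, z n + 10 ≤ z (n + 1) := fun n => by linarith [hA n, le_max_left (z n) (g (z n))]
  have hlow : ∀ n, b + 5 ≤ min (z n) (g (z n)) := by
    intro n
    induction n with
    | zero => exact le_min hA0 hB0
    | succ n ih =>
      have h1 := min_le_left (z n) (g (z n))
      have h2 := le_max_left (z n) (g (z n))
      exact le_min (by linarith [hA n]) (by linarith [hB n])
  have hub : ∀ n : ℕ, b + 10 * n ≤ z n := by
    intro n
    induction n with
    | zero => push_cast; linarith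
    | succ n ih => push_cast; linarith [hz n]
  have hmono : StrictMono z := strictMono_nat_of_lt_succ (fun n => by linarith [hz n])
  have hlr : ∀ n, min (z n) (g (z n)) - 1 < max (z n) (g (z n)) + 1 := fun n => by
    linarith [min_le_max (a := z n) (b := g (z n))]
  have hgap : ∀ n, max (z n) (g (z n)) + 1 + 2 < min (z (n + 1)) (g (z (n + 1))) - 1 := fun n => by
    have := le_min (hA n) (hB n)
    linarith
  obtain ⟨n0, hn0⟩ := discrete hH (fun n => min (z n) (g (z n)) - 1)
    (fun n => max (z n) (g (z n)) + 1) hlr hgap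
  have hk : ∀ n, ∃ t ∈ K (Set.Ioo (min (z n) (g (z n)) - 1) (max (z n) (g (z n)) + 1)),
      t (z n) = g (z n) := by
    intro n
    have h1 := min_le_left (z n) (g (z n))
    have h2 := le_max_left (z n) (g (z n))
    have h3 := min_le_right (z n) (g (z n))
    have h4 := le_max_right (z n) (g (z n))
    apply exists_move <;> linarith
  choose t ht ht' using hk
  have hpd : Pairwise (Function.onFun Disjoint (fun n =>
      Set.Ico (min (z n) (g (z n)) - 1) (max (z n) (g (z n)) + 1))) := by
    refine pairwise_disj (l := fun n => min (z n) (g (z n)) - 1)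
      (r := fun n => max (z n) (g (z n)) + 1) _ 2 (seq_gap 2 (by norm_num) hlr hgap) ?_
    intro n q hq
    have := hq.1
    have := hq.2
    constructor <;> linarith
  obtain ⟨k, hk, hk'⟩ := glue_s2 (fun i : {n : ℕ // n0 ≤ n} =>
      Set.Ico (min (z i) (g (z i)) - 1) (max (z i) (g (z i)) + 1)) (by
      intro a b hab
      exact hpd (fun h => hab (Subtype.ext h))) (fun i => t i)
      (fun i => K_mono Set.Ioo_subset_Ico_self (ht i))
  have hkH : k ∈ H := hn0 hk
  set g1 := k⁻¹ * g with hg1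
  have hfix1 : ∀ n, n0 ≤ n → g1 (z n) = z n := by
    intro n hn
    have h1 : k (z n) = g (z n) := by
      rw [hk' ⟨n, hn⟩ (z n), ht' n]
      have h1 := min_le_left (z n) (g (z n))
      have h2 := le_max_left (z n) (g (z n))
      exact ⟨by simp only; linarith, by simp only; linarith⟩
    rw [hg1, RelIso.mul_apply, ← h1, RelIso.inv_apply_self]
  have hlo1 : ∀ q, q ≤ b → g1 q = q := by
    intro q hq
    rw [hg1, RelIso.mul_apply, hg q (by simpa using hq)]
    apply (K _).inv_mem hk
    intro h
    obtain ⟨i, hi⟩ := Set.mem_iUnion.1 h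
    have := hi.1
    linarith [hlow i]
  obtain ⟨N1, r1, hr1, hor1, hfx1⟩ := peel hH g1 z hz n0 hfix1 0
  obtain ⟨N2, r2, hr2, hor2, hfx2⟩ := peel hH (r1⁻¹ * g1) z hz n0 (by
    intro n hn
    rcases hor1 (z n) with h | h
    · exact h
    · rw [h, hfix1 n hn]) 1
  have hfin : r2⁻¹ * (r1⁻¹ * g1) ∈ H := by
    apply hb (z (2 * (N1 + N2)))
    intro q hq
    have hor : ∀ q, (r1⁻¹ * g1) q = q → (r2⁻¹ * (r1⁻¹ * g1)) q = q := by
      intro q hq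
      rcases hor2 q with h | h
      · exact h
      · rw [h, hq]
    by_cases hqb : q ≤ b
    · apply hor
      rcases hor1 q with h | h
      · exact h
      · rw [h, hlo1 q hqb]
    · have hqz : z (2 * (N1 + N2)) ≤ q := by
        by_contra h
        exact hq ⟨not_le.1 hqb, not_le.1 h⟩
      have hex : ∃ n, q < z n := by
        obtain ⟨n, hn⟩ := exists_nat_gt (q - b)
        have h0 : (0 : ℚ) ≤ n := Nat.cast_nonneg n
        exact ⟨n, by linarith [hub n]⟩
      classical
      have hlt : 2 * (N1 + N2) < Nat.find hex := by
        by_contra h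
        have h1 := Nat.find_spec hex
        have h2 := hmono.monotone (not_lt.1 h)
        linarith
      obtain ⟨m, hm⟩ := Nat.exists_eq_succ_of_ne_zero (n := Nat.find hex) (by omega)
      have hlt2 : q < z (m + 1) := by
        have h1 := Nat.find_spec hex
        rwa [hm] at h1
      have hle : z m ≤ q := by
        have := Nat.find_min hex (m := m) (by omega)
        exact not_lt.1 this
      rcases Nat.even_or_odd' m with ⟨c, hc | hc⟩
      · apply hor
        exact hfx1 c (by omega) q ⟨by simpa [← hc] using hle, by simpa [← hc] using hlt2⟩
      · exact hfx2 c (by omega) q ⟨by rw [← hc]; exact hle, by rw [← hc]; exact hlt2⟩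
  have e : g = k * (r1 * (r2 * (r2⁻¹ * (r1⁻¹ * g1)))) := by
    rw [hg1]; group
  rw [e]
  exact H.mul_mem hkH (H.mul_mem hr1 (H.mul_mem hr2 hfin))

theorem step1neg {H : Subgroup (ℚ ≃o ℚ)} (hH : Small H) : ∃ b : ℚ, K (Set.Iio b) ≤ H := by
  have h1 : ∀ g : ℚ ≃o ℚ, ∃ f : ℚ ≃o ℚ, ∀ q, f q = -g (-q) := by
    intro g
    apply exists_iso _ (fun q => -g⁻¹ (-q))
    · intro x y hxy
      simp only
      rw [neg_lt_neg_iff, g.lt_iff_lt]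
      linarith
    · intro q
      simp only [neg_neg, RelIso.apply_inv_self]
  choose ν hν using h1
  let ψ : (ℚ ≃o ℚ) →* (ℚ ≃o ℚ) := MonoidHom.mk' ν (by
    intro a b
    ext q
    simp only [hν, RelIso.mul_apply, neg_neg])
  obtain ⟨b, hb⟩ := step1 (hH.comap ψ)
  refine ⟨-b, ?_⟩
  intro g hg
  have h2 : ν g ∈ K (Set.Ioi b) := by
    intro q hq
    rw [hν, hg (-q), neg_neg]
    intro h
    apply hq
    simp only [Set.mem_Iio, Set.mem_Ioi] at *
    linarith
  have h3 : ν (ν g) ∈ H := hb h2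
  have h4 : ν (ν g) = g := by
    ext q
    simp only [hν, neg_neg]
  rwa [h4] at h3

theorem transport {S : Set ℚ} (hS : S.OrdConnected) (e : ℚ ≃o S) :
    ∃ ψ : (ℚ ≃o ℚ) →* (ℚ ≃o ℚ), ∀ (H : Subgroup (ℚ ≃o ℚ)) (T : Set ℚ),
      K T ≤ H.comap ψ ↔ K ((fun q => (e q : ℚ)) '' T) ≤ H := by
  classical
  have hF : ∀ g : ℚ ≃o ℚ, ∃ f : ℚ ≃o ℚ, (∀ q, f (e q) = e (g q)) ∧ ∀ q, q ∉ S → f q = q := by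
    intro g
    obtain ⟨f, hf⟩ := exists_iso
      (fun q => if h : q ∈ S then (e (g (e.symm ⟨q, h⟩)) : ℚ) else q)
      (fun q => if h : q ∈ S then (e (g⁻¹ (e.symm ⟨q, h⟩)) : ℚ) else q) (by
        intro x y hxy
        by_cases hx : x ∈ S <;> by_cases hy : y ∈ S
        · simp only [dif_pos hx, dif_pos hy, Subtype.coe_lt_coe, OrderIso.lt_iff_lt]
          exact hxy
        · simp only [dif_pos hx, dif_neg hy]
          by_contra hcon
          exact hy (hS.out hx (e (g (e.symm ⟨x, hx⟩))).2 ⟨hxy.le, not_lt.1 hcon⟩)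
        · simp only [dif_neg hx, dif_pos hy]
          by_contra hcon
          exact hx (hS.out (e (g (e.symm ⟨y, hy⟩))).2 hy ⟨not_lt.1 hcon, hxy.le⟩)
        · simpa only [dif_neg hx, dif_neg hy] using hxy) (by
        intro q
        by_cases hq : q ∈ S
        · simp [hq]
        · simp [hq])
    refine ⟨f, ?_, ?_⟩
    · intro q
      rw [hf]
      simp
    · intro q hq
      rw [hf, dif_neg hq]
  choose ν hν hν' using hF
  have hcov : ∀ q ∈ S, ∃ w, (e w : ℚ) = q := fun q hq => ⟨e.symm ⟨q, hq⟩, by simp⟩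
  let ψ : (ℚ ≃o ℚ) →* (ℚ ≃o ℚ) := MonoidHom.mk' ν (by
    intro a b
    ext q
    rw [RelIso.mul_apply]
    by_cases hq : q ∈ S
    · obtain ⟨w, rfl⟩ := hcov q hq
      rw [hν, hν, hν, RelIso.mul_apply]
    · rw [hν' _ _ hq, hν' _ _ hq, hν' _ _ hq])
  refine ⟨ψ, ?_⟩
  intro H T
  constructor
  · intro h g hg
    have hsub : (fun q => (e q : ℚ)) '' T ⊆ S := by
      rintro _ ⟨w, _, rfl⟩
      exact (e w).2
    have hgS := K_mono hsub hg
    obtain ⟨g', hg'⟩ := exists_iso (fun q => e.symm ⟨g (e q), K_map hgS (e q).2⟩)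
      (fun q => e.symm ⟨g⁻¹ (e q), K_map ((K S).inv_mem hgS) (e q).2⟩) (by
        intro x y hxy
        simp only [OrderIso.lt_iff_lt, Subtype.mk_lt_mk, Subtype.coe_lt_coe]
        exact hxy) (by
        intro q
        simp)
    have heq : ν g' = g := by
      ext q
      by_cases hq : q ∈ S
      · obtain ⟨w, rfl⟩ := hcov q hq
        rw [hν, hg']
        simp
      · rw [hν' _ _ hq, hgS _ hq]
    have hgT : g' ∈ K T := by
      intro q hq
      have h1 : g (e q) = e q := by
        apply hg
        rintro ⟨w, hw, hwe⟩
        have : w = q := e.injective (Subtype.ext hwe)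
        exact hq (this ▸ hw)
      rw [hg']
      simp [h1]
    have := h hgT
    have h5 : ν g' ∈ H := this
    rwa [heq] at h5
  · intro h g hg
    apply h
    intro q hq
    change ν g q = q
    by_cases hqS : q ∈ S
    · obtain ⟨w, rfl⟩ := hcov q hqS
      rw [hν, hg w]
      intro hw
      exact hq ⟨w, hw, rfl⟩
    · exact hν' _ _ hqS

theorem cantor {S : Set ℚ} (hS : S.OrdConnected) (hne : S.Nonempty)
    (hmax : ∀ x ∈ S, ∃ y ∈ S, x < y) (hmin : ∀ x ∈ S, ∃ y ∈ S, y < x) : Nonempty (ℚ ≃o S) := by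
  have : Nonempty S := hne.to_subtype
  have : NoMaxOrder S := ⟨fun x => by
    obtain ⟨y, hy, h⟩ := hmax x x.2
    exact ⟨⟨y, hy⟩, h⟩⟩
  have : NoMinOrder S := ⟨fun x => by
    obtain ⟨y, hy, h⟩ := hmin x x.2
    exact ⟨⟨y, hy⟩, h⟩⟩
  have : DenselyOrdered S := ⟨fun x y hxy => by
    obtain ⟨z, h1, h2⟩ := exists_between (show (x : ℚ) < y from hxy)
    exact ⟨⟨z, hS.out x.2 y.2 ⟨h1.le, h2.le⟩⟩, h1, h2⟩⟩
  exact Order.iso_of_countable_dense ℚ S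

end SIP

namespace SIP

/-- An irrational cut of the rationals. -/
structure Cut (L : Set ℚ) : Prop where
  lower : IsLowerSet L
  ne : L.Nonempty
  ne' : Lᶜ.Nonempty
  nomax : ∀ x ∈ L, ∃ y ∈ L, x < y
  nomin : ∀ x ∈ Lᶜ, ∃ y ∈ Lᶜ, y < x

theorem Cut.isos {L : Set ℚ} (h : Cut L) : Nonempty (ℚ ≃o L) ∧ Nonempty (ℚ ≃o (Lᶜ : Set ℚ)) := by
  constructor
  · apply cantor h.lower.ordConnected h.ne h.nomax
    intro x hx
    exact ⟨x - 1, h.lower (by linarith) hx, by linarith⟩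
  · apply cantor h.lower.compl.ordConnected h.ne' _ h.nomin
    intro x hx
    exact ⟨x + 1, h.lower.compl (by linarith) hx, by linarith⟩

theorem cut_iso {L M : Set ℚ} (hL : Cut L) (hM : Cut M) :
    ∃ f : ℚ ≃o ℚ, ∀ q, f q ∈ M ↔ q ∈ L := by
  classical
  obtain ⟨⟨a⟩, ⟨b⟩⟩ := hL.isos
  obtain ⟨⟨c⟩, ⟨d⟩⟩ := hM.isos
  let e1 : L ≃o M := a.symm.trans c
  let e2 : (Lᶜ : Set ℚ) ≃o (Mᶜ : Set ℚ) := b.symm.trans d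
  have hcross : ∀ x ∈ M, ∀ y ∈ Mᶜ, x < y := by
    intro x hx y hy
    by_contra h
    exact hy (hM.lower (not_lt.1 h) hx)
  let F : ℚ → ℚ := fun q => if h : q ∈ L then (e1 ⟨q, h⟩ : ℚ) else (e2 ⟨q, h⟩ : ℚ)
  have hF1 : ∀ q (h : q ∈ L), F q = e1 ⟨q, h⟩ := fun q h => by simp only [F, dif_pos h]
  have hF2 : ∀ q (h : q ∉ L), F q = e2 ⟨q, h⟩ := fun q h => by simp only [F, dif_neg h]
  obtain ⟨f, hf⟩ := exists_iso F
    (fun q => if h : q ∈ M then (e1.symm ⟨q, h⟩ : ℚ) else (e2.symm ⟨q, h⟩ : ℚ)) (by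
      intro x y hxy
      by_cases hx : x ∈ L <;> by_cases hy : y ∈ L
      · rw [hF1 x hx, hF1 y hy, Subtype.coe_lt_coe, OrderIso.lt_iff_lt]
        exact hxy
      · rw [hF1 x hx, hF2 y hy]
        exact hcross _ (e1 _).2 _ (e2 _).2
      · exact absurd (hL.lower hxy.le hy) hx
      · rw [hF2 x hx, hF2 y hy, Subtype.coe_lt_coe, OrderIso.lt_iff_lt]
        exact hxy) (by
      intro q
      by_cases hq : q ∈ M
      · simp only [dif_pos hq]
        rw [hF1 _ (e1.symm ⟨q, hq⟩).2]
        simp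
      · simp only [dif_neg hq]
        rw [hF2 _ (e2.symm ⟨q, hq⟩).2]
        simp)
  refine ⟨f, ?_⟩
  intro q
  rw [hf]
  by_cases hq : q ∈ L
  · rw [hF1 q hq]
    exact ⟨fun _ => hq, fun _ => (e1 _).2⟩
  · rw [hF2 q hq]
    exact ⟨fun h => absurd h (e2 _).2, fun h => absurd h hq⟩

theorem cut_real (x : ℝ) (hx : Irrational x) : Cut {q : ℚ | (q : ℝ) < x} where
  lower := by
    intro a b hba ha
    have : (b : ℝ) ≤ a := by exact_mod_cast hba
    exact lt_of_le_of_lt this ha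
  ne := by
    obtain ⟨q, hq⟩ := exists_rat_lt x
    exact ⟨q, hq⟩
  ne' := by
    obtain ⟨q, hq⟩ := exists_rat_gt x
    exact ⟨q, not_lt.2 (le_of_lt hq)⟩
  nomax := by
    intro a ha
    obtain ⟨q, h1, h2⟩ := exists_rat_btwn (show (a : ℝ) < x from ha)
    exact ⟨q, h2, by exact_mod_cast h1⟩
  nomin := by
    intro a ha
    have h0 : x < a := lt_of_le_of_ne (not_lt.1 ha) (fun h => hx ⟨a, h.symm⟩)
    obtain ⟨q, h1, h2⟩ := exists_rat_btwn h0
    exact ⟨q, not_lt.2 (le_of_lt h1), by exact_mod_cast h2⟩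

theorem exists_irr : ∃ ρ : (ℕ → Bool) → ℝ, Function.Injective ρ ∧ ∀ x, Irrational (ρ x) := by
  have h1 : Cardinal.mk ((Set.range ((↑) : ℚ → ℝ))ᶜ : Set ℝ) = Cardinal.mk ℝ := by
    apply Cardinal.mk_compl_of_infinite
    refine lt_of_le_of_lt (Set.countable_range _).le_aleph0 ?_
    rw [Cardinal.mk_real]
    exact Cardinal.aleph0_lt_continuum
  have h2 : Cardinal.mk (ℕ → Bool) = Cardinal.mk ((Set.range ((↑) : ℚ → ℝ))ᶜ : Set ℝ) := by
    rw [h1, Cardinal.mk_real]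
    simp
  obtain ⟨e⟩ := Cardinal.eq.1 h2
  exact ⟨fun x => e x, fun x y h => e.injective (Subtype.ext h), fun x => (e x).2⟩

theorem cut_all {H : Subgroup (ℚ ≃o ℚ)} (hH : Small H) {L : Set ℚ} (hL : Cut L)
    (h1 : K L ≤ H) (h2 : K Lᶜ ≤ H) (g : ℚ ≃o ℚ) : g ∈ H := by
  have hz : ∃ h ∈ H, ∃ z, z ∉ L ∧ h⁻¹ z ∈ L := by
    obtain ⟨ρ, hρ, hirr⟩ := exists_irr
    have := fun x => cut_iso hL (cut_real (ρ x) (hirr x))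
    choose f hf using this
    have key : ∀ x y, (f x)⁻¹ * f y ∈ H → ρ x < ρ y → ∃ h ∈ H, ∃ z, z ∉ L ∧ h⁻¹ z ∈ L := by
      intro x y hxy hlt
      obtain ⟨s, hs1, hs2⟩ := exists_rat_btwn hlt
      refine ⟨_, hxy, (f x)⁻¹ s, ?_, ?_⟩
      · rw [← hf x, RelIso.apply_inv_self]
        exact not_lt.2 (le_of_lt hs1)
      · rw [mul_inv_rev, inv_inv, RelIso.mul_apply, RelIso.apply_inv_self, ← hf y,
          RelIso.apply_inv_self]
        exact hs2
    obtain ⟨x, y, hne, hxy⟩ := hH f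
    rcases lt_or_gt_of_ne (fun h => hne (hρ h)) with h | h
    · exact key x y hxy h
    · refine key y x ?_ h
      have := H.inv_mem hxy
      simpa using this
  obtain ⟨h, hh, z, hzL, hzM⟩ := hz
  set M : Set ℚ := h '' L with hM
  have hMmem : ∀ q, q ∈ M ↔ h⁻¹ q ∈ L := by
    intro q
    constructor
    · rintro ⟨w, hw, rfl⟩
      rwa [RelIso.inv_apply_self]
    · intro hq
      exact ⟨_, hq, RelIso.apply_inv_self h q⟩
  have hML : IsLowerSet M := by
    intro a b hba ha
    rw [hMmem] at *
    exact hL.lower ((h⁻¹).le_iff_le.2 hba) ha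
  have hMmax : ∀ x ∈ M, ∃ y ∈ M, x < y := by
    intro x hx
    rw [hMmem] at hx
    obtain ⟨y, hy, hxy⟩ := hL.nomax _ hx
    refine ⟨h y, ⟨y, hy, rfl⟩, ?_⟩
    have := h.lt_iff_lt.2 hxy
    rwa [RelIso.apply_inv_self] at this
  have hKM : K M ≤ H := by
    intro k hk
    have h3 := K_conj (h := h⁻¹) hk
    have h4 : h⁻¹ * k * h⁻¹⁻¹ ∈ H := by
      apply h1
      refine K_mono ?_ h3
      rintro _ ⟨w, hw, rfl⟩
      exact (hMmem w).1 hw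
    have := H.mul_mem (H.mul_mem hh h4) (H.inv_mem hh)
    have e : h * (h⁻¹ * k * h⁻¹⁻¹) * h⁻¹ = k := by group
    rwa [e] at this
  have hzM' : z ∈ M := (hMmem z).2 hzM
  have hk : ∃ k ∈ H, k z = g z := by
    by_cases hgz : g z ∈ M
    · have hmax : max z (g z) ∈ M := by
        rcases max_choice z (g z) with h | h <;> rw [h] <;> assumption
      obtain ⟨b, hb, hlt⟩ := hMmax _ hmax
      obtain ⟨t, ht, ht'⟩ := exists_move (a := min z (g z) - 1) (c := z) (d := g z) (b := b)
        (by linarith [min_le_left z (g z)]) (lt_of_le_of_lt (le_max_left _ _) hlt)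
        (by linarith [min_le_right z (g z)]) (lt_of_le_of_lt (le_max_right _ _) hlt)
      refine ⟨t, hKM (K_mono ?_ ht), ht'⟩
      intro q hq
      exact hML hq.2.le hb
    · have hgL : g z ∉ L := by
        intro hgL
        apply hgz
        refine hML ?_ hzM'
        by_contra hcon
        exact hzL (hL.lower (not_le.1 hcon).le hgL)
      have hmin : min z (g z) ∈ Lᶜ := by
        rcases min_choice z (g z) with h | h <;> rw [h] <;> assumption
      obtain ⟨a, ha, hlt⟩ := hL.nomin _ hmin
      obtain ⟨t, ht, ht'⟩ := exists_move (a := a) (c := z) (d := g z) (b := max z (g z) + 1)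
        (lt_of_lt_of_le hlt (min_le_left _ _)) (by linarith [le_max_left z (g z)])
        (lt_of_lt_of_le hlt (min_le_right _ _)) (by linarith [le_max_right z (g z)])
      refine ⟨t, h2 (K_mono ?_ ht), ht'⟩
      intro q hq
      exact hL.lower.compl hq.1.le ha
  obtain ⟨k, hkH, hkz⟩ := hk
  set g1 := k⁻¹ * g with hg1
  have hg1z : g1 z = z := by
    rw [hg1, RelIso.mul_apply, ← hkz, RelIso.inv_apply_self]
  have hiff : ∀ q, g1 q < z ↔ q < z := by
    intro q
    conv_lhs => rw [← hg1z]
    rw [g1.lt_iff_lt]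
  obtain ⟨r, hr, hr'⟩ := restr (fun _ : Unit => Set.Iio z)
    (fun a b hab => absurd (Subsingleton.elim a b) hab) (fun _ => Set.ordConnected_Iio) g1
    (fun _ q => hiff q)
  rw [Set.iUnion_const] at hr hr'
  have hrH : r ∈ H := by
    apply hKM
    refine K_mono ?_ hr
    intro q hq
    exact hML (le_of_lt hq) hzM'
  have h3 : r⁻¹ * g1 ∈ H := by
    apply h2
    intro q hq
    have hqL : q ∈ L := not_not.1 hq
    have hqz : q < z := by
      by_contra hcon
      exact hzL (hL.lower (not_lt.1 hcon) hqL)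
    rw [RelIso.mul_apply, ← hr' q hqz, RelIso.inv_apply_self]
  have e : g = k * (r * (r⁻¹ * g1)) := by rw [hg1]; group
  rw [e]
  exact H.mul_mem hkH (H.mul_mem hrH h3)

theorem cantor_real {A B : ℝ} (hAB : A < B) :
    ({q : ℚ | A < q ∧ (q : ℝ) < B}).OrdConnected ∧ Nonempty (ℚ ≃o {q : ℚ | A < q ∧ (q : ℝ) < B}) := by
  have hc : ({q : ℚ | A < q ∧ (q : ℝ) < B}).OrdConnected := by
    constructor
    intro x hx y hy w hw
    have h1 : (x : ℝ) ≤ w := by exact_mod_cast hw.1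
    have h2 : (w : ℝ) ≤ y := by exact_mod_cast hw.2
    exact ⟨lt_of_lt_of_le hx.1 h1, lt_of_le_of_lt h2 hy.2⟩
  refine ⟨hc, cantor hc ?_ ?_ ?_⟩
  · obtain ⟨q, h1, h2⟩ := exists_rat_btwn hAB
    exact ⟨q, h1, h2⟩
  · intro x hx
    obtain ⟨q, h1, h2⟩ := exists_rat_btwn hx.2
    exact ⟨q, ⟨hx.1.trans h1, h2⟩, by exact_mod_cast h1⟩
  · intro x hx
    obtain ⟨q, h1, h2⟩ := exists_rat_btwn hx.1
    exact ⟨q, ⟨h1, h2.trans hx.2⟩, by exact_mod_cast h2⟩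

theorem left_side {H : Subgroup (ℚ ≃o ℚ)} (hH : Small H) (p : ℝ) :
    ∃ c : ℚ, (c : ℝ) < p ∧ K {q : ℚ | c < q ∧ (q : ℝ) < p} ≤ H := by
  obtain ⟨hc, ⟨e⟩⟩ := cantor_real (show p - 1 < p by linarith)
  obtain ⟨ψ, hψ⟩ := transport hc e
  obtain ⟨b, hb⟩ := step1 (hH.comap ψ)
  refine ⟨e b, (e b).2.2, le_trans (K_mono ?_) ((hψ H _).1 hb)⟩
  rintro q ⟨h1, h2⟩
  have hqS : q ∈ {q : ℚ | p - 1 < q ∧ (q : ℝ) < p} :=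
    ⟨(e b).2.1.trans (by exact_mod_cast h1), h2⟩
  refine ⟨e.symm ⟨q, hqS⟩, ?_, by simp⟩
  rw [Set.mem_Ioi, e.lt_symm_apply]
  exact h1

theorem right_side {H : Subgroup (ℚ ≃o ℚ)} (hH : Small H) (p : ℝ) :
    ∃ c : ℚ, p < c ∧ K {q : ℚ | p < q ∧ q < c} ≤ H := by
  obtain ⟨hc, ⟨e⟩⟩ := cantor_real (show p < p + 1 by linarith)
  obtain ⟨ψ, hψ⟩ := transport hc e
  obtain ⟨b, hb⟩ := step1neg (hH.comap ψ)
  refine ⟨e b, (e b).2.1, le_trans (K_mono ?_) ((hψ H _).1 hb)⟩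
  rintro q ⟨h1, h2⟩
  have h3 : (q : ℝ) < ((e b : ℚ) : ℝ) := by exact_mod_cast h2
  have hqS : q ∈ {q : ℚ | p < q ∧ (q : ℝ) < p + 1} := ⟨h1, h3.trans (e b).2.2⟩
  refine ⟨e.symm ⟨q, hqS⟩, ?_, by simp⟩
  rw [Set.mem_Iio, e.symm_apply_lt]
  exact h2

theorem irr_nhd {H : Subgroup (ℚ ≃o ℚ)} (hH : Small H) {p : ℝ} (hp : Irrational p) {c d : ℚ}
    (hc : (c : ℝ) < p) (hd : p < d) (h1 : K {q : ℚ | c < q ∧ (q : ℝ) < p} ≤ H)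
    (h2 : K {q : ℚ | p < q ∧ q < d} ≤ H) : K (Set.Ioo c d) ≤ H := by
  obtain ⟨hcc, ⟨e⟩⟩ := cantor_real (hc.trans hd)
  obtain ⟨ψ, hψ⟩ := transport hcc e
  have hcov : ∀ q : ℚ, c < q → q < d → ∃ w, (e w : ℚ) = q := fun q hq1 hq2 =>
    ⟨e.symm ⟨q, by exact_mod_cast hq1, by exact_mod_cast hq2⟩, by simp⟩
  have hlo : ∀ w, c < (e w : ℚ) := fun w => by exact_mod_cast (e w).2.1
  have hhi : ∀ w, (e w : ℚ) < d := fun w => by exact_mod_cast (e w).2.2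
  have hle : ∀ a b, (e a : ℚ) ≤ e b ↔ a ≤ b := fun a b => by
    rw [Subtype.coe_le_coe, e.le_iff_le]
  have hlt : ∀ a b, (e a : ℚ) < e b ↔ a < b := fun a b => by
    rw [Subtype.coe_lt_coe, e.lt_iff_lt]
  let L : Set ℚ := {w | ((e w : ℚ) : ℝ) < p}
  have hLc : ∀ w, w ∈ Lᶜ → p < ((e w : ℚ) : ℝ) := fun w hw =>
    lt_of_le_of_ne (not_lt.1 hw) (fun h => hp ⟨_, h.symm⟩)
  have hL : Cut L := by
    refine ⟨?_, ?_, ?_, ?_, ?_⟩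
    · intro a b hba ha
      have h3 : (e b : ℚ) ≤ e a := (hle b a).2 hba
      have h4 : ((e b : ℚ) : ℝ) ≤ ((e a : ℚ) : ℝ) := by exact_mod_cast h3
      exact lt_of_le_of_lt h4 ha
    · obtain ⟨q, hq1, hq2⟩ := exists_rat_btwn hc
      have h4 : (q : ℝ) < d := hq2.trans hd
      obtain ⟨w, rfl⟩ := hcov q (by exact_mod_cast hq1) (by exact_mod_cast h4)
      exact ⟨w, hq2⟩
    · obtain ⟨q, hq1, hq2⟩ := exists_rat_btwn hd
      have h4 : (c : ℝ) < q := hc.trans hq1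
      obtain ⟨w, rfl⟩ := hcov q (by exact_mod_cast h4) (by exact_mod_cast hq2)
      exact ⟨w, not_lt.2 hq1.le⟩
    · intro x hx
      obtain ⟨q, hq1, hq2⟩ := exists_rat_btwn (show ((e x : ℚ) : ℝ) < p from hx)
      have h3 : (e x : ℚ) < q := by exact_mod_cast hq1
      have h4 : (q : ℝ) < d := hq2.trans hd
      obtain ⟨w, rfl⟩ := hcov q ((hlo x).trans h3) (by exact_mod_cast h4)
      exact ⟨w, hq2, (hlt _ _).1 h3⟩
    · intro x hx
      obtain ⟨q, hq1, hq2⟩ := exists_rat_btwn (hLc x hx)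
      have h3 : q < (e x : ℚ) := by exact_mod_cast hq2
      have h4 : (c : ℝ) < q := hc.trans hq1
      obtain ⟨w, rfl⟩ := hcov q (by exact_mod_cast h4) (h3.trans (hhi x))
      exact ⟨w, not_lt.2 hq1.le, (hlt _ _).1 h3⟩
  have hall := cut_all (hH.comap ψ) hL
    ((hψ H _).2 (le_trans (K_mono (by
      rintro _ ⟨w, hw, rfl⟩
      exact ⟨hlo w, hw⟩)) h1))
    ((hψ H _).2 (le_trans (K_mono (by
      rintro _ ⟨w, hw, rfl⟩
      exact ⟨hLc w hw, hhi w⟩)) h2))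
  refine le_trans (K_mono ?_) ((hψ H Set.univ).1 (fun g _ => hall g))
  rintro q ⟨hq1, hq2⟩
  obtain ⟨w, rfl⟩ := hcov q hq1 hq2
  exact ⟨w, trivial, rfl⟩

/-- Local form of the conclusion. -/
def Loc (H : Subgroup (ℚ ≃o ℚ)) (s : Set ℝ) : Prop :=
  ∃ A : Set ℚ, A.Finite ∧ ∀ g : ℚ ≃o ℚ, (∀ a ∈ A, g a = a) →
    ∃ h ∈ H, (∀ q : ℚ, (q : ℝ) ∈ s → h q = g q) ∧ ∀ q, h q = q ∨ h q = g q

theorem Loc.mono {H : Subgroup (ℚ ≃o ℚ)} {s t : Set ℝ} (hst : s ⊆ t) (h : Loc H t) : Loc H s := by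
  obtain ⟨A, hA, h⟩ := h
  refine ⟨A, hA, fun g hg => ?_⟩
  obtain ⟨k, hk, h1, h2⟩ := h g hg
  exact ⟨k, hk, fun q hq => h1 q (hst hq), h2⟩

theorem Loc.union {H : Subgroup (ℚ ≃o ℚ)} {s t : Set ℝ} (hs : Loc H s) (ht : Loc H t) :
    Loc H (s ∪ t) := by
  obtain ⟨A, hA, h⟩ := hs
  obtain ⟨B, hB, h'⟩ := ht
  refine ⟨A ∪ B, hA.union hB, fun g hg => ?_⟩
  obtain ⟨k, hk, h1, h2⟩ := h g (fun a ha => hg a (Or.inl ha))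
  have hinv : ∀ q, k q = g q → (k⁻¹ * g) q = q := by
    intro q hq
    rw [RelIso.mul_apply, ← hq, RelIso.inv_apply_self]
  obtain ⟨k', hk', h1', h2'⟩ := h' (k⁻¹ * g) (fun a ha => by
    apply hinv
    have h3 := hg a (Or.inr ha)
    rcases h2 a with h | h
    · rw [h, h3]
    · exact h)
  have hval : ∀ q, k' q = (k⁻¹ * g) q → (k * k') q = g q := by
    intro q hq
    rw [RelIso.mul_apply, hq, RelIso.mul_apply, RelIso.apply_inv_self]
  refine ⟨k * k', H.mul_mem hk hk', ?_, ?_⟩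
  · rintro q (hq | hq)
    · have h3 := h1 q hq
      apply hval
      rcases h2' q with h | h
      · rw [h, hinv q h3]
      · exact h
    · exact hval q (h1' q hq)
  · intro q
    rcases h2' q with h | h
    · rw [RelIso.mul_apply, h]
      exact h2 q
    · exact Or.inr (hval q h)

theorem Loc.of_K {H : Subgroup (ℚ ≃o ℚ)} {s : Set ℝ} {S A : Set ℚ} (hS : S.OrdConnected)
    (hK : K S ≤ H) (hA : A.Finite)
    (hinv : ∀ g : ℚ ≃o ℚ, (∀ a ∈ A, g a = a) → ∀ q, g q ∈ S ↔ q ∈ S)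
    (hs : ∀ q : ℚ, (q : ℝ) ∈ s → q ∈ S) : Loc H s := by
  refine ⟨A, hA, fun g hg => ?_⟩
  obtain ⟨r, hr, hr'⟩ := restr (fun _ : Unit => S)
    (fun a b hab => absurd (Subsingleton.elim a b) hab) (fun _ => hS) g
    (fun _ q => hinv g hg q)
  rw [Set.iUnion_const] at hr hr'
  refine ⟨r, hK hr, fun q hq => hr' q (hs q hq), fun q => ?_⟩
  by_cases hq : q ∈ S
  · exact Or.inr (hr' q hq)
  · exact Or.inl (hr q hq)

theorem lt_fix {g : ℚ ≃o ℚ} {a : ℚ} (h : g a = a) (q : ℚ) : (g q < a ↔ q < a) := by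
  conv_lhs => rw [← h]
  exact g.lt_iff_lt

theorem fix_lt {g : ℚ ≃o ℚ} {a : ℚ} (h : g a = a) (q : ℚ) : (a < g q ↔ a < q) := by
  conv_lhs => rw [← h]
  exact g.lt_iff_lt

theorem Loc.Ioo {H : Subgroup (ℚ ≃o ℚ)} {c d : ℚ} (h : K (Set.Ioo c d) ≤ H) :
    Loc H (Set.Ioo (c : ℝ) d) := by
  refine Loc.of_K (S := Set.Ioo c d) (A := {c, d}) Set.ordConnected_Ioo h (by simp) ?_ ?_
  · intro g hg q
    rw [Set.mem_Ioo, Set.mem_Ioo, fix_lt (hg c (by simp)), lt_fix (hg d (by simp))]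
  · intro q hq
    exact ⟨by exact_mod_cast hq.1, by exact_mod_cast hq.2⟩

theorem Loc.nhd {H : Subgroup (ℚ ≃o ℚ)} (hH : Small H) (p : ℝ) :
    ∃ c d : ℚ, (c : ℝ) < p ∧ p < d ∧ Loc H (Set.Ioo (c : ℝ) d) := by
  obtain ⟨c, hc, h1⟩ := left_side hH p
  obtain ⟨d, hd, h2⟩ := right_side hH p
  refine ⟨c, d, hc, hd, ?_⟩
  by_cases hp : Irrational p
  · exact Loc.Ioo (irr_nhd hH hp hc hd h1 h2)
  · obtain ⟨p0, rfl⟩ := not_not.1 hp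
    have a1 : Loc H (Set.Ioo (c : ℝ) p0) := Loc.Ioo (le_trans (K_mono (by
      intro q hq
      exact ⟨hq.1, by exact_mod_cast hq.2⟩)) h1)
    have a2 : Loc H (Set.Ioo (p0 : ℝ) d) := Loc.Ioo (le_trans (K_mono (by
      intro q hq
      exact ⟨by exact_mod_cast hq.1, hq.2⟩)) h2)
    have a3 : Loc H {(p0 : ℝ)} := by
      refine ⟨{p0}, by simp, fun g hg => ⟨1, H.one_mem, ?_, fun q => Or.inl rfl⟩⟩
      intro q hq
      have : q = p0 := by exact_mod_cast (show (q : ℝ) = p0 from hq)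
      rw [this, hg p0 (by simp)]
      rfl
    refine Loc.mono ?_ ((a1.union a3).union a2)
    intro x hx
    rcases lt_trichotomy x p0 with h | h | h
    · exact Or.inl (Or.inl ⟨hx.1, h⟩)
    · exact Or.inl (Or.inr h)
    · exact Or.inr ⟨h, hx.2⟩

theorem Loc.univ {H : Subgroup (ℚ ≃o ℚ)} (hH : Small H) : Loc H Set.univ := by
  obtain ⟨b, hb⟩ := step1 hH
  obtain ⟨a, ha⟩ := step1neg hH
  have h1 : Loc H (Set.Ioi (b : ℝ)) := by
    refine Loc.of_K (A := {b}) Set.ordConnected_Ioi hb (by simp) ?_ ?_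
    · intro g hg q
      exact fix_lt (hg b (by simp)) q
    · intro q hq
      have h : (b : ℝ) < q := hq
      exact (by exact_mod_cast h : b < q)
  have h2 : Loc H (Set.Iio (a : ℝ)) := by
    refine Loc.of_K (A := {a}) Set.ordConnected_Iio ha (by simp) ?_ ?_
    · intro g hg q
      exact lt_fix (hg a (by simp)) q
    · intro q hq
      have h : (q : ℝ) < a := hq
      exact (by exact_mod_cast h : q < a)
  have h3 : Loc H (Set.Icc (a : ℝ) b) := by
    refine isCompact_Icc.induction_on (p := Loc H) ?_ (fun s t hst ht => ht.mono hst)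
      (fun s t hs ht => hs.union ht) ?_
    · exact ⟨∅, Set.finite_empty, fun g _ => ⟨1, H.one_mem, by simp, fun q => Or.inl rfl⟩⟩
    · intro x _
      obtain ⟨c, d, hc, hd, h⟩ := Loc.nhd hH x
      exact ⟨_, mem_nhdsWithin_of_mem_nhds (Ioo_mem_nhds hc hd), h⟩
  refine Loc.mono ?_ ((h1.union h2).union h3)
  intro x _
  by_cases hx1 : (b : ℝ) < x
  · exact Or.inl (Or.inl hx1)
  · by_cases hx2 : x < a
    · exact Or.inl (Or.inr hx2)
    · exact Or.inr ⟨not_lt.1 hx2, not_lt.1 hx1⟩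

end SIP

/-- Small index property for `Aut(ℚ,<)` (Truss): any subgroup of the group of
order-automorphisms of `ℚ` of index `< 2^ℵ₀` contains the pointwise stabilizer
of a finite set. -/
theorem smallIndexProperty_orderAutRat (H : Subgroup (ℚ ≃o ℚ))
    (hindex : Cardinal.mk ((ℚ ≃o ℚ) ⧸ H) < 2 ^ Cardinal.aleph0) :
    ∃ A : Set ℚ, A.Finite ∧ ∀ g : ℚ ≃o ℚ, (∀ a ∈ A, g a = a) → g ∈ H := by
  obtain ⟨A, hA, h⟩ := SIP.Loc.univ (SIP.small_of_index H hindex)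
  refine ⟨A, hA, fun g hg => ?_⟩
  obtain ⟨k, hk, h1, -⟩ := h g hg
  have : g = k := by
    ext q
    exact (h1 q trivial).symm
  rw [this]
  exact hk
end
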